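/- arXiv:2401.06328 — 5 statements merged into one kernel-verified Lean document; each statement's English description precedes it below -/
import Mathlib

section
/- Let V be a normed real vector space with Module.finrank ℝ V = 2 which is a strictly convex space (StrictConvexSpace ℝ V), and let s₁, s₂, s₃ ∈ V be three points that are not collinear (¬ Collinear ℝ {s₁, s₂, s₃}). Then the set P = {p : V | each of ‖p − s₁‖, ‖p − s₂‖, ‖p − s₃‖ equals some natural number} is finite, and its cardinality satisfies P.ncard ≤ 2 · (2·⌊‖s₁ − s₂‖⌋ + 1) · (2·⌊‖s₁ − s₃‖⌋ + 1). -/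
/-- The median of three real numbers. -/
def medianOfThree (a b c : ℝ) : ℝ := max (min a b) (min (max a b) c)

lemma medianOfThree_neg (a b c : ℝ) :
    medianOfThree (-a) (-b) (-c) = -medianOfThree a b c := by
  unfold medianOfThree
  grind

lemma cases_of_medianOfThree_eq_zero {x y z : ℝ} (h : medianOfThree x y z = 0) :
    (x = 0 ∧ (y ≤ 0 ∧ 0 ≤ z ∨ z ≤ 0 ∧ 0 ≤ y)) ∨
      (y = 0 ∧ (x ≤ 0 ∧ 0 ≤ z ∨ z ≤ 0 ∧ 0 ≤ x)) ∨
      (z = 0 ∧ (x ≤ 0 ∧ 0 ≤ y ∨ y ≤ 0 ∧ 0 ≤ x)) := by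
  unfold medianOfThree at h
  rcases le_total x y with h₁ | h₁ <;> rcases le_total y z with h₂ | h₂ <;>
    rcases le_total x z with h₃ | h₃ <;> simp [h₁, h₂, h₃] at h <;> subst h <;> simp [*]

lemma continuous_medianOfThree :
    Continuous fun x : ℝ × ℝ × ℝ => medianOfThree x.1 x.2.1 x.2.2 := by
  unfold medianOfThree
  fun_prop

/-- Two triples whose medians have the same weak sign admit a nontrivial combination, with
weights of opposite sign, whose median vanishes. -/
lemma exists_medianOfThree_eq_zero {a b c a' b' c' : ℝ}
    (h : 0 ≤ medianOfThree a b c ↔ 0 ≤ medianOfThree a' b' c') :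
    ∃ t ∈ Set.Icc (0 : ℝ) 1,
      medianOfThree ((1 - t) * a - t * a') ((1 - t) * b - t * b') ((1 - t) * c - t * c') = 0 := by
  set g : ℝ → ℝ := fun t =>
    medianOfThree ((1 - t) * a - t * a') ((1 - t) * b - t * b') ((1 - t) * c - t * c') with hg
  have hcont : Continuous g :=
    continuous_medianOfThree.comp (f := fun t : ℝ =>
      ((1 - t) * a - t * a', (1 - t) * b - t * b', (1 - t) * c - t * c')) (by fun_prop)
  have h0 : g 0 = medianOfThree a b c := by simp [hg]
  have h1 : g 1 = -medianOfThree a' b' c' := by simp [hg, medianOfThree_neg]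
  have hzero : (0 : ℝ) ∈ Set.uIcc (g 0) (g 1) := by
    rw [h0, h1, Set.mem_uIcc]
    by_cases hs : 0 ≤ medianOfThree a b c
    · exact Or.inr ⟨by linarith [h.1 hs], hs⟩
    · have := mt h.2 hs
      exact Or.inl ⟨by linarith, by linarith⟩
  obtain ⟨t, ht, hgt⟩ := intermediate_value_uIcc hcont.continuousOn hzero
  exact ⟨t, by simpa using ht, hgt⟩

section StrictConvex

variable {V : Type*} [NormedAddCommGroup V] [NormedSpace ℝ V]

lemma wbtw_of_smul_add_smul {a b : ℝ} (ha : 0 ≤ a) (hb : 0 ≤ b) (hab : 0 < a + b) (p s : V) :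
    Wbtw ℝ p ((a + b)⁻¹ • (a • p + b • s)) s := by
  refine ⟨b / (a + b), ⟨by positivity, by rw [div_le_one hab]; linarith⟩, ?_⟩
  rw [AffineMap.lineMap_apply_module, smul_add, smul_smul, smul_smul]
  congr 2
  · field_simp
    ring
  · field_simp

variable [StrictConvexSpace ℝ V]

/-- If the segment from `p` to `s` meets the segment from `q` to `r`, and the difference of
distances to `p` and to `q` is the same at `s` and `r`, then every point with this
difference of distances lies on the line through `p` and `q`. -/
lemma mem_line_of_segments_meet {p q s r x : V} (hpq : p ≠ q) (hsr : s ≠ r)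
    (hps : Wbtw ℝ p x s) (hqr : Wbtw ℝ q x r)
    (hd : dist p s - dist q s = dist p r - dist q r) {y : V}
    (hy : dist p s - dist q s = dist p y - dist q y) : y ∈ line[ℝ, p, q] := by
  have e₁ := hps.dist_add_dist
  have e₂ := hqr.dist_add_dist
  have i₁ := dist_triangle p x r
  have i₂ := dist_triangle q x s
  have hpr : Wbtw ℝ p x r := dist_add_dist_eq_iff.1 (by linarith)
  have hqs : Wbtw ℝ q x s := dist_add_dist_eq_iff.1 (by linarith)
  have total : ∀ z, z ≠ x → Wbtw ℝ p x z → Wbtw ℝ q x z → Wbtw ℝ z p q ∨ Wbtw ℝ z q p := by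
    intro z hz h₁ h₂
    refine wbtw_total_of_sameRay_vsub_left ?_
    have k₁ := h₁.symm.sameRay_vsub_left
    have k₂ := h₂.symm.sameRay_vsub_left
    exact k₁.symm.trans k₂ fun h => absurd (vsub_eq_zero_iff_eq.1 h).symm hz
  have main : ∀ z, dist p s - dist q s = dist p z - dist q z → Wbtw ℝ z p q ∨ Wbtw ℝ z q p →
      y ∈ line[ℝ, p, q] := by
    intro z hz h
    rcases h with h | h
    · have e := h.dist_add_dist
      have : Wbtw ℝ q p y := dist_add_dist_eq_iff.1 (by
        rw [dist_comm z p, dist_comm z q] at e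
        rw [dist_comm q p]
        linarith)
      rw [Set.pair_comm]
      exact this.right_mem_affineSpan_of_left_ne hpq.symm
    · have e := h.dist_add_dist
      have : Wbtw ℝ p q y := dist_add_dist_eq_iff.1 (by
        rw [dist_comm z p, dist_comm z q] at e
        rw [dist_comm q p] at e
        linarith)
      exact this.right_mem_affineSpan_of_left_ne hpq
  by_cases hsx : s = x
  · exact main r hd (total r (fun h => hsr (hsx.trans h.symm)) hpr hqr)
  · exact main s rfl (total s hsx hps hqs)

/-- Two distinct points whose distances to three non-collinear sites differ by a common constant
have barycentric coordinates with medians of different sign. -/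
lemma eq_of_dist_sub_dist_eq_of_median_sign {s₁ s₂ s₃ : V}
    (hcol : ¬ Collinear ℝ ({s₁, s₂, s₃} : Set V)) {p q : V} {a b c a' b' c' : ℝ}
    (hsum : a + b + c = 1) (hp : a • s₁ + b • s₂ + c • s₃ = p)
    (hsum' : a' + b' + c' = 1) (hq : a' • s₁ + b' • s₂ + c' • s₃ = q)
    (h₂ : dist p s₁ - dist q s₁ = dist p s₂ - dist q s₂)
    (h₃ : dist p s₁ - dist q s₁ = dist p s₃ - dist q s₃)
    (h : 0 ≤ medianOfThree a b c ↔ 0 ≤ medianOfThree a' b' c') : p = q := by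
  by_contra hpq
  obtain ⟨t, ⟨ht0, ht1⟩, ht⟩ := exists_medianOfThree_eq_zero h
  have contra : ∀ s r : V, s ≠ r → dist p s₁ - dist q s₁ = dist p s - dist q s →
      dist p s₁ - dist q s₁ = dist p r - dist q r → ∀ u v : ℝ, 0 ≤ u → 0 ≤ v →
      1 - t + u = t + v → (1 - t) • p + u • s = t • q + v • r → False := by
    intro s r hsr hs hr u v hu hv huv he
    have hpos : 0 < 1 - t + u := by
      by_contra hn
      linarith
    have w₁ := wbtw_of_smul_add_smul (sub_nonneg.2 ht1) hu hpos p s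
    have w₂ := wbtw_of_smul_add_smul ht0 hv (huv ▸ hpos) q r
    rw [← huv, ← he] at w₂
    have mem : ∀ y, dist p s₁ - dist q s₁ = dist p y - dist q y → y ∈ line[ℝ, p, q] :=
      fun y hy => mem_line_of_segments_meet hpq hsr w₁ w₂ (hs.symm.trans hr) (hs.symm.trans hy)
    exact hcol (collinear_triple_of_mem_affineSpan_pair (mem _ rfl) (mem _ h₂) (mem _ h₃))
  have h12 : s₁ ≠ s₂ := by
    rintro rfl
    exact hcol (by simpa using collinear_pair ℝ s₁ s₃)
  have h13 : s₁ ≠ s₃ := by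
    rintro rfl
    exact hcol (by simpa [Set.pair_comm] using collinear_pair ℝ s₁ s₂)
  have h23 : s₂ ≠ s₃ := by
    rintro rfl
    exact hcol (by simpa using collinear_pair ℝ s₁ s₂)
  set x := (1 - t) * a - t * a' with hx
  set y := (1 - t) * b - t * b' with hy
  set z := (1 - t) * c - t * c' with hz
  have hxyz : x + y + z = 1 - 2 * t := by
    rw [hx, hy, hz]
    linear_combination (1 - t) * hsum - t * hsum'
  have hcomb : (1 - t) • p - t • q = x • s₁ + y • s₂ + z • s₃ := by
    rw [← hp, ← hq, hx, hy, hz]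
    module
  clear_value x y z
  rcases cases_of_medianOfThree_eq_zero ht with ⟨h0, ⟨hn, hp⟩ | ⟨hn, hp⟩⟩ |
    ⟨h0, ⟨hn, hp⟩ | ⟨hn, hp⟩⟩ | ⟨h0, ⟨hn, hp⟩ | ⟨hn, hp⟩⟩ <;> rw [h0] at hcomb hxyz
  · exact contra s₂ s₃ h23 h₂ h₃ (-y) z (by linarith) hp (by linarith)
      (by linear_combination (norm := module) hcomb)
  · exact contra s₃ s₂ h23.symm h₃ h₂ (-z) y (by linarith) hp (by linarith)
      (by linear_combination (norm := module) hcomb)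
  · exact contra s₁ s₃ h13 rfl h₃ (-x) z (by linarith) hp (by linarith)
      (by linear_combination (norm := module) hcomb)
  · exact contra s₃ s₁ h13.symm h₃ rfl (-z) x (by linarith) hp (by linarith)
      (by linear_combination (norm := module) hcomb)
  · exact contra s₁ s₂ h12 rfl h₂ (-x) y (by linarith) hp (by linarith)
      (by linear_combination (norm := module) hcomb)
  · exact contra s₂ s₁ h12.symm h₂ rfl (-y) x (by linarith) hp (by linarith)
      (by linear_combination (norm := module) hcomb)

end StrictConvex

lemma exists_barycentric_coords {V : Type*} [NormedAddCommGroup V] [NormedSpace ℝ V]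
    (hdim : Module.finrank ℝ V = 2) {s₁ s₂ s₃ : V}
    (hcol : ¬ Collinear ℝ ({s₁, s₂, s₃} : Set V)) (p : V) :
    ∃ a b c : ℝ, a + b + c = 1 ∧ a • s₁ + b • s₂ + c • s₃ = p := by
  have : FiniteDimensional ℝ V := Module.finite_of_finrank_eq_succ hdim
  have hind := affineIndependent_iff_not_collinear_set.2 hcol
  have htop := hind.affineSpan_eq_top_iff_card_eq_finrank_add_one.2 (by simp [hdim])
  let B : AffineBasis (Fin 3) ℝ V := ⟨_, hind, htop⟩
  refine ⟨B.coord 0 p, B.coord 1 p, B.coord 2 p, ?_, ?_⟩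
  · rw [← Fin.sum_univ_three fun i => B.coord i p]
    exact B.sum_coord_apply_eq_one p
  · have := B.linear_combination_coord_eq_self p
    rwa [Fin.sum_univ_three] at this

/-- The difference of two integer distances is an integer bounded by the distance of the sites. -/
lemma floor_norm_sub_norm_sub {V : Type*} [NormedAddCommGroup V] {p s r : V}
    (hs : ∃ n : ℕ, ‖p - s‖ = n) (hr : ∃ n : ℕ, ‖p - r‖ = n) :
    (⌊‖p - s‖ - ‖p - r‖⌋ : ℝ) = ‖p - s‖ - ‖p - r‖ ∧
      ⌊‖p - s‖ - ‖p - r‖⌋ ∈ Finset.Icc (-⌊‖s - r‖⌋) ⌊‖s - r‖⌋ := by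
  obtain ⟨m, hm⟩ := hs
  obtain ⟨n, hn⟩ := hr
  have hfloor : ⌊‖p - s‖ - ‖p - r‖⌋ = (m : ℤ) - n := by
    rw [hm, hn, Int.floor_eq_iff]
    push_cast
    constructor <;> linarith
  have habs : |‖p - s‖ - ‖p - r‖| ≤ ‖s - r‖ := by
    have := abs_norm_sub_norm_le (p - s) (p - r)
    rwa [sub_sub_sub_cancel_left, norm_sub_rev r s] at this
  rw [hm, hn, abs_le] at habs
  rw [hfloor, Finset.mem_Icc, neg_le, Int.le_floor, Int.le_floor, hm, hn]
  push_cast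
  exact ⟨rfl, by linarith, by linarith⟩


/-- For three non-collinear points in a 2-dimensional strictly convex normed space,
the set of points at integer distances from all three is finite, with at most
`2 * (2*⌊‖s₁ - s₂‖⌋ + 1) * (2*⌊‖s₁ - s₃‖⌋ + 1)` elements. -/
theorem erdos_anning_triangle_strictly_convex
    {V : Type*} [NormedAddCommGroup V] [NormedSpace ℝ V]
    (hdim : Module.finrank ℝ V = 2) [StrictConvexSpace ℝ V]
    (s₁ s₂ s₃ : V) (hcol : ¬ Collinear ℝ ({s₁, s₂, s₃} : Set V))
    (P : Set V)
    (hP : P = {p : V | (∃ n : ℕ, ‖p - s₁‖ = n) ∧ (∃ n : ℕ, ‖p - s₂‖ = n) ∧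
      (∃ n : ℕ, ‖p - s₃‖ = n)}) :
    P.Finite ∧
      (P.ncard : ℤ) ≤ 2 * (2 * ⌊‖s₁ - s₂‖⌋ + 1) * (2 * ⌊‖s₁ - s₃‖⌋ + 1) := by
  classical
  choose a b c hsum hcomb using exists_barycentric_coords hdim hcol
  let f : V → ℤ × ℤ × Bool := fun p =>
    (⌊‖p - s₁‖ - ‖p - s₂‖⌋, ⌊‖p - s₁‖ - ‖p - s₃‖⌋,
      decide (0 ≤ medianOfThree (a p) (b p) (c p)))
  let T : Finset (ℤ × ℤ × Bool) :=
    Finset.Icc (-⌊‖s₁ - s₂‖⌋) ⌊‖s₁ - s₂‖⌋ ×ˢ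
      Finset.Icc (-⌊‖s₁ - s₃‖⌋) ⌊‖s₁ - s₃‖⌋ ×ˢ Finset.univ
  have hmaps : Set.MapsTo f P T := by
    intro p hp
    rw [hP] at hp
    obtain ⟨h₁, h₂, h₃⟩ := hp
    rw [Finset.mem_coe, Finset.mem_product, Finset.mem_product]
    exact ⟨(floor_norm_sub_norm_sub h₁ h₂).2, (floor_norm_sub_norm_sub h₁ h₃).2,
      Finset.mem_univ _⟩
  have hinj : Set.InjOn f P := by
    intro p hp q hq hpq
    rw [hP] at hp hq
    obtain ⟨hp₁, hp₂, hp₃⟩ := hp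
    obtain ⟨hq₁, hq₂, hq₃⟩ := hq
    obtain ⟨e₂, e₃, e⟩ : _ ∧ _ ∧ _ := by simpa only [f, Prod.mk.injEq] using hpq
    have k₂ := congrArg (Int.cast : ℤ → ℝ) e₂
    have k₃ := congrArg (Int.cast : ℤ → ℝ) e₃
    rw [(floor_norm_sub_norm_sub hp₁ hp₂).1, (floor_norm_sub_norm_sub hq₁ hq₂).1] at k₂
    rw [(floor_norm_sub_norm_sub hp₁ hp₃).1, (floor_norm_sub_norm_sub hq₁ hq₃).1] at k₃
    refine eq_of_dist_sub_dist_eq_of_median_sign hcol (hsum p) (hcomb p) (hsum q) (hcomb q)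
      ?_ ?_ (decide_eq_decide.1 e) <;> simp only [dist_eq_norm] <;> linarith
  refine ⟨Set.Finite.of_injOn hmaps hinj T.finite_toSet, ?_⟩
  have hcard : P.ncard ≤ T.card := by
    rw [← Set.ncard_coe_finset]
    exact Set.ncard_le_ncard_of_injOn f hmaps hinj T.finite_toSet
  have h₂ : 0 ≤ ⌊‖s₁ - s₂‖⌋ := Int.floor_nonneg.2 (norm_nonneg _)
  have h₃ : 0 ≤ ⌊‖s₁ - s₃‖⌋ := Int.floor_nonneg.2 (norm_nonneg _)
  calc (P.ncard : ℤ) ≤ T.card := by exact_mod_cast hcard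
    _ = 2 * (2 * ⌊‖s₁ - s₂‖⌋ + 1) * (2 * ⌊‖s₁ - s₃‖⌋ + 1) := by
      simp only [T, Finset.card_product, Int.card_Icc, Finset.card_univ, Fintype.card_bool]
      push_cast
      rw [Int.toNat_of_nonneg (by linarith), Int.toNat_of_nonneg (by linarith)]
      ring
end

section
/- Let V be a normed real vector space with Module.finrank ℝ V = 2 which is a strictly convex space (StrictConvexSpace ℝ V). Then there exists a constant C > 0 (depending only on V and its norm) such that: for every real D ≥ 0 and every set S ⊆ V with the properties that all pairwise distances ‖p − q‖ (p, q ∈ S) are natural numbers and ‖p − q‖ ≤ D for all p, q ∈ S, the set S is finite and S.ncard ≤ C · (D + 1). -/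
section IntegerDistances

variable {V : Type*} [NormedAddCommGroup V] [NormedSpace ℝ V]

theorem Fin.eq_or_eq_or_eq_of_ne {i j k : Fin 3} (hij : i ≠ j) (hjk : j ≠ k) (hik : i ≠ k)
    (l : Fin 3) : l = i ∨ l = j ∨ l = k := by
  revert i j k l; decide

theorem AffineBasis.coord_add_coord_add_coord (B : AffineBasis (Fin 3) ℝ V)
    {i j k : Fin 3} (hij : i ≠ j) (hjk : j ≠ k) (hik : i ≠ k) (y : V) :
    B.coord i y + B.coord j y + B.coord k y = 1 := by
  have huniv : (Finset.univ : Finset (Fin 3)) = {i, j, k} := by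
    ext l; simpa using Fin.eq_or_eq_or_eq_of_ne hij hjk hik l
  rw [← B.sum_coord_apply_eq_one y, huniv, Finset.sum_insert (by simp [hij, hik]),
    Finset.sum_insert (by simp [hjk]), Finset.sum_singleton, add_assoc]

/-- Segments joining `p` to `B i` and `q` to `B j` cross under the stated coordinate inequalities;
strict convexity forbids this when `p` and `q` have equal distance differences to `B i`, `B j`. -/
theorem AffineBasis.false_of_crossing [StrictConvexSpace ℝ V] (B : AffineBasis (Fin 3) ℝ V)
    {i j k : Fin 3} (hij : i ≠ j) (hjk : j ≠ k) (hik : i ≠ k) {p q : V} (hpq : p ≠ q)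
    (hd : dist p (B i) + dist q (B j) = dist p (B j) + dist q (B i))
    {g : ℝ} (hg : 0 < g) (hk : B.coord k p = g * B.coord k q) (hk0 : B.coord k q ≠ 0)
    (hi : B.coord i p ≤ g * B.coord i q) (hj : g * B.coord j q ≤ B.coord j p) : False := by
  have hall := Fin.eq_or_eq_or_eq_of_ne hij hjk hik
  have hp := B.coord_add_coord_add_coord hij hjk hik p
  have hq := B.coord_add_coord_add_coord hij hjk hik q
  set N := 1 - B.coord i p + g * B.coord i q with hN
  have hN1 : 1 ≤ N := by linarith
  have hNg : g ≤ N := by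
    have : g * (B.coord i q + B.coord j q + B.coord k q) = g := by rw [hq, mul_one]
    linarith
  have hN0 : 0 < N := by linarith
  set a := 1 / N with ha
  have haN : a * N = 1 := by rw [ha]; field_simp
  have ha0 : 0 < a := by positivity
  have ha1 : a ≤ 1 := by rw [ha, div_le_one hN0]; exact hN1
  have hag : a * g ≤ 1 := by rw [ha, div_mul_eq_mul_div, one_mul, div_le_one hN0]; exact hNg
  have hkp0 : B.coord k p ≠ 0 := by rw [hk]; positivity
  obtain ⟨x, hx⟩ : ∃ x, x = AffineMap.lineMap (B i) p a := ⟨_, rfl⟩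
  have hx' : x = AffineMap.lineMap (B j) q (a * g) := by
    rw [hx]
    apply B.ext_elem
    intro l
    rw [AffineMap.apply_lineMap, AffineMap.apply_lineMap, AffineMap.lineMap_apply_ring,
      AffineMap.lineMap_apply_ring]
    have e1 : (1 - a) + a * B.coord i p = a * g * B.coord i q := by
      rw [hN] at haN; linarith
    rcases hall l with rfl | rfl | rfl
    · simp only [AffineBasis.coord_apply_eq, B.coord_apply_ne hij]
      linarith
    · simp only [AffineBasis.coord_apply_eq, B.coord_apply_ne hij.symm]
      have : a * g * (B.coord i q + B.coord l q + B.coord k q) = a * g := by rw [hq, mul_one]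
      have h2 : a * (B.coord i p + B.coord l p + B.coord k p) = a := by rw [hp, mul_one]
      rw [hk] at h2
      linarith
    · simp only [B.coord_apply_ne hjk.symm, B.coord_apply_ne hik.symm, hk]
      ring
  have w1 : Wbtw ℝ (B i) x p := ⟨a, ⟨ha0.le, ha1⟩, hx.symm⟩
  have w2 : Wbtw ℝ (B j) x q := ⟨a * g, ⟨by positivity, hag⟩, hx'.symm⟩
  have d1 := w1.dist_add_dist
  have d2 := w2.dist_add_dist
  have t1 := dist_triangle (B j) x p
  have t2 := dist_triangle (B i) x q
  rw [dist_comm p, dist_comm q, dist_comm p, dist_comm q] at hd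
  obtain ⟨m, hm, hmx⟩ := (dist_add_dist_eq_iff (a := B j) (b := x) (c := p)).1 (by linarith)
  obtain ⟨n, hn, hnx⟩ := (dist_add_dist_eq_iff (a := B i) (b := x) (c := q)).1 (by linarith)
  have f1 := hx ▸ hmx
  have f2 := hx' ▸ hnx
  have g1 := congrArg (B.coord k) f1
  have g2 := congrArg (B.coord i) f1
  have g3 := congrArg (B.coord k) f2
  have g4 := congrArg (B.coord j) f2
  rw [AffineMap.apply_lineMap, AffineMap.apply_lineMap, AffineMap.lineMap_apply_ring,
      AffineMap.lineMap_apply_ring] at g1 g2 g3 g4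
  simp only [B.coord_apply_ne hjk.symm, B.coord_apply_ne hik.symm, AffineBasis.coord_apply_eq,
    B.coord_apply_ne hij, B.coord_apply_ne hij.symm, mul_zero, zero_add] at g1 g2 g3 g4
  have m1 := mul_right_cancel₀ hkp0 g1
  have m2 := mul_right_cancel₀ hk0 g3
  have a1 : a = 1 := by rw [m1] at g2; linarith
  have a2 : a * g = 1 := by rw [m2] at g4; linarith
  rw [a2] at hx'
  rw [a1] at hx
  apply hpq
  simp at hx hx'
  rw [← hx, hx']

theorem AffineBasis.eq_of_dist_add_dist [StrictConvexSpace ℝ V] (B : AffineBasis (Fin 3) ℝ V)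
    {k : Fin 3} {p q : V} (hp : B.coord k p = 0) (hq : B.coord k q = 0)
    (h : dist p q + dist q (B k) = dist p (B k)) : p = q := by
  obtain ⟨m, -, hm⟩ := dist_add_dist_eq_iff.1 h
  have := congrArg (B.coord k) hm
  rw [AffineMap.apply_lineMap, AffineMap.lineMap_apply_ring] at this
  simp [hp, hq] at this
  simpa [this] using hm

theorem AffineBasis.eq_of_coord_eq_zero [StrictConvexSpace ℝ V] (B : AffineBasis (Fin 3) ℝ V)
    {i j k : Fin 3} (hij : i ≠ j) (hjk : j ≠ k) (hik : i ≠ k) {p q : V} {d : ℝ}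
    (hd : ∀ l, dist p (B l) - dist q (B l) = d)
    (hp : B.coord k p = 0) (hq : B.coord k q = 0) : p = q := by
  have hall := Fin.eq_or_eq_or_eq_of_ne hij hjk hik
  have key : ∀ y, B.coord k y = 0 → y = AffineMap.lineMap (B i) (B j) (B.coord j y) := by
    intro y hy
    have hsum := B.coord_add_coord_add_coord hij hjk hik y
    apply B.ext_elem
    intro l
    rw [AffineMap.apply_lineMap, AffineMap.lineMap_apply_ring]
    rcases hall l with rfl | rfl | rfl
    · simp only [AffineBasis.coord_apply_eq, B.coord_apply_ne hij]
      linarith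
    · simp only [AffineBasis.coord_apply_eq, B.coord_apply_ne hij.symm]
      ring
    · simp only [B.coord_apply_ne hjk.symm, B.coord_apply_ne hik.symm, hy]
      ring
  obtain ⟨s, hs⟩ : ∃ s, p = AffineMap.lineMap (B i) (B j) s := ⟨_, key p hp⟩
  obtain ⟨t, ht⟩ : ∃ t, q = AffineMap.lineMap (B i) (B j) t := ⟨_, key q hq⟩
  by_contra hpq
  have hst : s ≠ t := by rintro rfl; exact hpq (hs.trans ht.symm)
  have hL : 0 < dist (B i) (B j) := dist_pos.2 fun h => hij (B.ind.injective h)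
  have e1 := hd i
  have e2 := hd j
  have e3 := hd k
  have e4 : dist p q = |s - t| * dist (B i) (B j) := by
    rw [hs, ht, dist_lineMap_lineMap, Real.dist_eq]
  rw [hs, ht] at e1 e2
  simp only [dist_lineMap_left, dist_lineMap_right, Real.norm_eq_abs] at e1 e2
  have e5 : |s| - |t| = |1 - s| - |1 - t| := by
    apply mul_right_cancel₀ hL.ne'
    linarith
  have e6 : |s| - |t| = |s - t| ∨ |s| - |t| = - |s - t| := by
    grind
  rcases e6 with e6 | e6
  · have : d = dist p q := by rw [e4, ← e6]; linarith
    exact hpq (B.eq_of_dist_add_dist hp hq (by linarith))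
  · have : -d = dist p q := by
      have : |s - t| = |t| - |s| := by linarith
      rw [e4, this]; linarith
    exact hpq (B.eq_of_dist_add_dist hq hp (by rw [dist_comm q p]; linarith)).symm

theorem AffineBasis.eq_of_dist_sub_eq_of_sign_eq [StrictConvexSpace ℝ V]
    (B : AffineBasis (Fin 3) ℝ V) {p q : V} {d : ℝ}
    (hd : ∀ l, dist p (B l) - dist q (B l) = d)
    (hs : ∀ l, SignType.sign (B.coord l p) = SignType.sign (B.coord l q)) : p = q := by
  by_contra hpq
  have hne : ∀ l, B.coord l q ≠ 0 := by
    intro l hl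
    have hl' : B.coord l p = 0 := by
      have := hs l
      rwa [hl, sign_zero, sign_eq_zero_iff] at this
    obtain ⟨i, j, hij, hjl, hil⟩ : ∃ i j : Fin 3, i ≠ j ∧ j ≠ l ∧ i ≠ l := by
      clear hl hl'; revert l; decide
    exact hpq (B.eq_of_coord_eq_zero hij hjl hil hd hl' hl)
  have hratio : ∀ l, ∃ g : ℝ, 0 < g ∧ B.coord l p = g * B.coord l q := by
    intro l
    refine ⟨B.coord l p / B.coord l q, ?_, by field_simp [hne l]⟩
    rcases lt_or_gt_of_ne (hne l) with h | h
    · have := hs l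
      rw [sign_neg h, sign_eq_neg_one_iff] at this
      exact div_pos_of_neg_of_neg this h
    · have := hs l
      rw [sign_pos h, sign_eq_one_iff] at this
      exact div_pos this h
  choose g hg hgp using hratio
  have hmul : ∀ x y z : ℝ, (x ≤ y ∧ 0 ≤ z) ∨ (y ≤ x ∧ z ≤ 0) → x * z ≤ y * z := by
    rintro x y z (⟨h, hz⟩ | ⟨h, hz⟩)
    exacts [mul_le_mul_of_nonneg_right h hz, mul_le_mul_of_nonpos_right h hz]
  have H : ∀ i j k : Fin 3, i ≠ j → j ≠ k → i ≠ k →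
      (g i ≤ g k ∧ 0 ≤ B.coord i q) ∨ (g k ≤ g i ∧ B.coord i q ≤ 0) →
      (g k ≤ g j ∧ 0 ≤ B.coord j q) ∨ (g j ≤ g k ∧ B.coord j q ≤ 0) → False := by
    intro i j k hij hjk hik h1 h2
    refine B.false_of_crossing hij hjk hik hpq ?_ (hg k) (hgp k) (hne k) ?_ ?_
    · linarith [hd i, hd j]
    · rw [hgp i]; exact hmul _ _ _ h1
    · rw [hgp j]; exact hmul _ _ _ h2
  have H012 := H 0 1 2 (by decide) (by decide) (by decide)
  have H102 := H 1 0 2 (by decide) (by decide) (by decide)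
  have H021 := H 0 2 1 (by decide) (by decide) (by decide)
  have H201 := H 2 0 1 (by decide) (by decide) (by decide)
  have H120 := H 1 2 0 (by decide) (by decide) (by decide)
  have H210 := H 2 1 0 (by decide) (by decide) (by decide)
  clear H hmul hgp hg hne hs hd
  grind

/-- A set at integer distances from the vertices of a triangle has boundedly many points in
terms of two side lengths of the triangle. -/
theorem card_le_of_not_collinear [StrictConvexSpace ℝ V] (hdim : Module.finrank ℝ V = 2)
    {T : Finset V} (hT : ∀ p ∈ T, ∀ q ∈ T, ∃ n : ℕ, dist p q = n) {a b c : V}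
    (ha : a ∈ T) (hb : b ∈ T) (hc : c ∈ T) (habc : ¬ Collinear ℝ {a, b, c}) :
    (T.card : ℝ) ≤ 243 * (dist a b * dist a c) := by
  have : FiniteDimensional ℝ V := Module.finite_of_finrank_eq_succ hdim
  have hind := affineIndependent_iff_not_collinear_set.2 habc
  have htop := hind.affineSpan_eq_top_iff_card_eq_finrank_add_one.2 (by simp [hdim])
  let B : AffineBasis (Fin 3) ℝ V := ⟨![a, b, c], hind, htop⟩
  have hB0 : B 0 = a := rfl
  have hB1 : B 1 = b := rfl
  have hB2 : B 2 = c := rfl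
  have hBT : ∀ l, B l ∈ T := by
    intro l
    fin_cases l
    exacts [ha, hb, hc]
  have h01 : a ≠ b := fun h => absurd (B.ind.injective (hB0.trans (h.trans hB1.symm))) (by decide)
  have h02 : a ≠ c := fun h => absurd (B.ind.injective (hB0.trans (h.trans hB2.symm))) (by decide)
  obtain ⟨m, hm⟩ := hT a ha b hb
  obtain ⟨n, hn⟩ := hT a ha c hc
  have hm1 : (1 : ℝ) ≤ m := by
    have := dist_pos.2 h01
    rw [hm] at this
    exact_mod_cast this
  have hn1 : (1 : ℝ) ≤ n := by
    have := dist_pos.2 h02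
    rw [hn] at this
    exact_mod_cast this
  have hint : ∀ p ∈ T, ∀ l, ((⌊dist p (B 0) - dist p (B l)⌋ : ℤ) : ℝ)
      = dist p (B 0) - dist p (B l) := by
    intro p hp l
    obtain ⟨x, hx⟩ := hT p hp _ (hBT 0)
    obtain ⟨y, hy⟩ := hT p hp _ (hBT l)
    rw [hx, hy]
    have : (x : ℝ) - y = ((x - y : ℤ) : ℝ) := by push_cast; rfl
    rw [this, Int.floor_intCast]
  have hbound : ∀ p ∈ T, ∀ l, ∀ r : ℕ, dist (B 0) (B l) = r →
      ⌊dist p (B 0) - dist p (B l)⌋ ∈ Finset.Icc (-(r : ℤ)) r := by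
    intro p hp l r hr
    have := abs_le.1 (abs_dist_sub_le (B 0) (B l) p)
    rw [dist_comm (B 0) p, dist_comm (B l) p, ← hint p hp l, hr] at this
    rw [Finset.mem_Icc]
    exact ⟨by exact_mod_cast this.1, by exact_mod_cast this.2⟩
  have hcard := Finset.card_le_card_of_injOn (s := T)
    (t := Finset.Icc (-(m : ℤ)) m ×ˢ Finset.Icc (-(n : ℤ)) n ×ˢ
      (Finset.univ : Finset (Fin 3 → SignType)))
    (fun p => (⌊dist p (B 0) - dist p (B 1)⌋, ⌊dist p (B 0) - dist p (B 2)⌋,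
      fun l => SignType.sign (B.coord l p)))
    (fun p hp => by
      simp only [Finset.coe_product, Set.mem_prod, Finset.mem_coe]
      exact ⟨hbound p hp 1 m hm, hbound p hp 2 n hn, Finset.mem_univ _⟩)
    (fun p hp q hq hpq => by
      simp only [Prod.mk.injEq] at hpq
      obtain ⟨h1, h2, h3⟩ := hpq
      refine B.eq_of_dist_sub_eq_of_sign_eq (d := dist p (B 0) - dist q (B 0)) ?_
        (fun l => congrFun h3 l)
      have e1 := hint p hp 1
      have e2 := hint p hp 2
      rw [h1, hint q hq 1] at e1
      rw [h2, hint q hq 2] at e2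
      intro l
      fin_cases l
      · rfl
      · simp only [Fin.mk_one]; linarith
      · simp only [Fin.reduceFinMk]; linarith)
  have hsign : Fintype.card SignType = 3 := rfl
  simp only [Finset.card_product, Int.card_Icc, Finset.card_univ, Fintype.card_pi_const,
    hsign] at hcard
  have e1 : ((m : ℤ) + 1 - -(m : ℤ)).toNat = 2 * m + 1 := by omega
  have e2 : ((n : ℤ) + 1 - -(n : ℤ)).toNat = 2 * n + 1 := by omega
  rw [e1, e2] at hcard
  have hcard' : (T.card : ℝ) ≤ (2 * m + 1) * ((2 * n + 1) * 3 ^ 3) := by exact_mod_cast hcard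
  rw [hm, hn]
  nlinarith

/-- A collinear set with integer distances and diameter at most `D` has at most `3 * (D + 1)`
points. -/
theorem card_le_of_collinear {T : Finset V} (hT : ∀ p ∈ T, ∀ q ∈ T, ∃ n : ℕ, dist p q = n)
    {D : ℝ} (hD : 0 ≤ D) (hTD : ∀ p ∈ T, ∀ q ∈ T, dist p q ≤ D)
    (hcol : Collinear ℝ (T : Set V)) : (T.card : ℝ) ≤ 3 * (D + 1) := by
  rcases T.eq_empty_or_nonempty with rfl | ⟨a, ha⟩
  · simp; linarith
  obtain ⟨v, hv⟩ := (collinear_iff_of_mem (Finset.mem_coe.2 ha)).1 hcol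
  simp only [Finset.mem_coe, vadd_eq_add] at hv
  choose! r hr using hv
  have hdist : ∀ p ∈ T, dist p a = |r p| * ‖v‖ := by
    intro p hp
    nth_rewrite 1 [hr p hp]
    rw [dist_eq_norm, add_sub_cancel_right, norm_smul, Real.norm_eq_abs]
  have hfl : ∀ p ∈ T, ((⌊dist p a⌋₊ : ℕ) : ℝ) = dist p a := by
    intro p hp
    obtain ⟨n, hn⟩ := hT p hp a ha
    rw [hn, Nat.floor_natCast]
  have hcard := Finset.card_le_card_of_injOn (s := T)
    (t := Finset.range (⌊D⌋₊ + 1) ×ˢ (Finset.univ : Finset SignType))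
    (fun p => (⌊dist p a⌋₊, SignType.sign (r p)))
    (fun p hp => by
      simp only [Finset.coe_product, Set.mem_prod, Finset.mem_coe, Finset.mem_range,
        Finset.mem_univ, and_true]
      exact Nat.lt_succ_of_le (Nat.floor_le_floor (hTD p hp a ha)))
    (fun p hp q hq hpq => by
      simp only [Prod.mk.injEq] at hpq
      obtain ⟨h1, h2⟩ := hpq
      have h3 : dist p a = dist q a := by rw [← hfl p hp, ← hfl q hq, h1]
      rw [hdist p hp, hdist q hq] at h3
      rcases eq_or_ne v 0 with h0 | h0
      · rw [hr p hp, hr q hq, h0]; simp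
      · have h4 := mul_right_cancel₀ (norm_ne_zero_iff.2 h0) h3
        have h5 : r p = r q := by
          rw [← sign_mul_abs (r p), ← sign_mul_abs (r q), h2, h4]
        rw [hr p hp, hr q hq, h5])
  have hsign : Fintype.card SignType = 3 := rfl
  simp only [Finset.card_product, Finset.card_range, Finset.card_univ, hsign] at hcard
  have hcard' : (T.card : ℝ) ≤ (⌊D⌋₊ + 1) * 3 := by exact_mod_cast hcard
  linarith [Nat.floor_le hD]

theorem Collinear.exists_sub_eq_smul_sub {x y z : V} (h : Collinear ℝ {x, y, z}) (hyx : y ≠ x) :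
    ∃ t : ℝ, z - x = t • (y - x) := by
  obtain ⟨v, hv⟩ := (collinear_iff_of_mem (p₀ := x) (by simp)).1 h
  obtain ⟨s, hs⟩ := hv y (by simp)
  obtain ⟨t, ht⟩ := hv z (by simp)
  have hs0 : s ≠ 0 := by
    rintro rfl
    exact hyx (by simpa using hs)
  refine ⟨t / s, ?_⟩
  rw [hs, ht]
  simp only [vadd_eq_add, add_sub_cancel_right, smul_smul]
  field_simp

/-- A finite planar set is packed by boxes of area comparable to `A`, when around each point `p`
the set is collinear up to distance `r p`, where `r p` times the distance `s p` from `p` to its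
nearest neighbour `N p` equals `A`. -/
theorem card_mul_le_of_locally_collinear (e : V ≃L[ℝ] ℝ × ℝ) {M : ℝ} (hM : 1 ≤ M)
    (he : ∀ v, ‖e v‖ ≤ M * ‖v‖) (he' : ∀ v, ‖v‖ ≤ M * ‖e v‖) {T : Finset V} {D A : ℝ}
    (hTD : ∀ p ∈ T, ∀ q ∈ T, dist p q ≤ D) {s r : V → ℝ} {N : V → V}
    (hN : ∀ p ∈ T, N p ∈ T) (hNp : ∀ p ∈ T, N p ≠ p) (hNs : ∀ p ∈ T, dist p (N p) = s p)
    (hs : ∀ p ∈ T, ∀ q ∈ T, q ≠ p → s p ≤ dist p q)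
    (hcol : ∀ p ∈ T, ∀ q ∈ T, dist p q < r p → Collinear ℝ {p, N p, q})
    (hsr : ∀ p ∈ T, s p * r p = A) (hr0 : ∀ p ∈ T, 0 < r p) (hrD : ∀ p ∈ T, r p ≤ D) :
    T.card * A ≤ (8 * M * (M + 1) * D) ^ 2 := by
  classical
  rcases T.eq_empty_or_nonempty with rfl | ⟨o, ho⟩
  · simp; positivity
  have hs0 : ∀ p ∈ T, 0 < s p := fun p hp => by
    rw [← hNs p hp]; exact dist_pos.2 (hNp p hp).symm
  have hsD : ∀ p ∈ T, s p ≤ D := fun p hp => by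
    rw [← hNs p hp]; exact hTD p hp _ (hN p hp)
  have hD0 : 0 < D := (hr0 o ho).trans_le (hrD o ho)
  obtain ⟨c, hc⟩ : ∃ c : ℝ, c = 1 / (8 * M) := ⟨_, rfl⟩
  have hM0 : 0 < M := by linarith
  have hcM : M * c = 1 / 8 := by rw [hc]; field_simp
  have hc0 : 0 < c := by rw [hc]; positivity
  have hc1 : c ≤ 1 := by nlinarith
  let dir : V → Prop := fun v => |(e v).2| ≤ |(e v).1|
  have hdir : ∀ (t : ℝ) (v : V), t ≠ 0 → (dir (t • v) ↔ dir v) := by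
    intro t v ht
    simp only [dir, map_smul, Prod.smul_fst, Prod.smul_snd, smul_eq_mul, abs_mul]
    exact mul_le_mul_iff_right₀ (abs_pos.2 ht)
  let w : V → ℝ := fun p => if dir (N p - p) then c * s p else c * r p
  let h : V → ℝ := fun p => if dir (N p - p) then c * r p else c * s p
  let box : V → Set (ℝ × ℝ) := fun p =>
    Set.Icc ((e p).1 - w p) ((e p).1 + w p) ×ˢ Set.Icc ((e p).2 - h p) ((e p).2 + h p)
  have hw0 : ∀ p ∈ T, 0 ≤ w p := fun p hp => by
    have := hs0 p hp; have := hr0 p hp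
    simp only [w]; split_ifs <;> positivity
  have hh0 : ∀ p ∈ T, 0 ≤ h p := fun p hp => by
    have := hs0 p hp; have := hr0 p hp
    simp only [h]; split_ifs <;> positivity
  have hwD : ∀ p ∈ T, w p ≤ D := fun p hp => by
    have := hs0 p hp; have := hr0 p hp; have := hsD p hp; have := hrD p hp
    simp only [w]; split_ifs <;> nlinarith
  have hhD : ∀ p ∈ T, h p ≤ D := fun p hp => by
    have := hs0 p hp; have := hr0 p hp; have := hsD p hp; have := hrD p hp
    simp only [h]; split_ifs <;> nlinarith
  have hwh : ∀ p ∈ T, w p * h p = c ^ 2 * A := fun p hp => by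
    rw [← hsr p hp]
    simp only [w, h]; split_ifs <;> ring
  have hwsr : ∀ p ∈ T, w p ≤ c * (s p + r p) := fun p hp => by
    have := hs0 p hp; have := hr0 p hp
    simp only [w]; split_ifs <;> nlinarith
  have hhsr : ∀ p ∈ T, h p ≤ c * (s p + r p) := fun p hp => by
    have := hs0 p hp; have := hr0 p hp
    simp only [h]; split_ifs <;> nlinarith
  have hdisj : ∀ p ∈ T, ∀ q ∈ T, p ≠ q → r p ≤ r q → ∀ z, z ∈ box p → z ∈ box q → False := by
    intro p hp q hq hpq hr z hzp hzq
    simp only [box, Set.mem_prod, Set.mem_Icc] at hzp hzq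
    have h1 : |(e (p - q)).1| ≤ w p + w q := by
      rw [map_sub, Prod.fst_sub, abs_le]; constructor <;> linarith
    have h2 : |(e (p - q)).2| ≤ h p + h q := by
      rw [map_sub, Prod.snd_sub, abs_le]; constructor <;> linarith
    have hspq : s p ≤ dist p q := hs p hp q hq hpq.symm
    have hsqp : s q ≤ dist p q := by rw [dist_comm]; exact hs q hq p hp hpq
    have hrq := hr0 q hq
    have hd0 : 0 < dist p q := dist_pos.2 hpq
    have hed : dist p q ≤ M * ‖e (p - q)‖ := by rw [dist_eq_norm]; exact he' _
    have hen : ‖e (p - q)‖ ≤ c * (2 * dist p q + 2 * r q) := by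
      rw [Prod.norm_def, Real.norm_eq_abs, Real.norm_eq_abs]
      apply max_le
      · refine h1.trans ?_
        have := hwsr p hp; have := hwsr q hq
        nlinarith
      · refine h2.trans ?_
        have := hhsr p hp; have := hhsr q hq
        nlinarith
    have hclose : dist p q ≤ r q / 3 := by
      have : M * ‖e (p - q)‖ ≤ M * (c * (2 * dist p q + 2 * r q)) := by gcongr
      rw [← mul_assoc, hcM] at this
      linarith
    have hc1 := hcol q hq p hp (by rw [dist_comm]; linarith)
    have hc2 := hcol q hq (N p) (hN p hp) (by
      have := dist_triangle q p (N p)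
      rw [hNs p hp, dist_comm q p] at this
      linarith)
    obtain ⟨t1, ht1⟩ := hc1.exists_sub_eq_smul_sub (hNp q hq)
    obtain ⟨t2, ht2⟩ := hc2.exists_sub_eq_smul_sub (hNp q hq)
    have ht1' : t1 ≠ 0 := by
      rintro rfl
      rw [zero_smul, sub_eq_zero] at ht1
      exact hpq ht1
    have ht3 : N p - p = (t2 - t1) • (N q - q) := by
      rw [sub_smul, ← ht1, ← ht2]; abel
    have ht3' : t2 - t1 ≠ 0 := by
      intro h0
      rw [h0, zero_smul, sub_eq_zero] at ht3
      exact hNp p hp ht3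
    have hd1 : dir (N p - p) ↔ dir (N q - q) := by rw [ht3]; exact hdir _ _ ht3'
    have hd2 : dir (p - q) ↔ dir (N q - q) := by rw [ht1]; exact hdir _ _ ht1'
    have hsmall : ‖e (p - q)‖ ≤ c * (2 * dist p q) := by
      rw [Prod.norm_def, Real.norm_eq_abs, Real.norm_eq_abs]
      by_cases hd : dir (p - q)
      · rw [max_eq_left hd]
        refine h1.trans ?_
        simp only [w, if_pos (hd1.2 (hd2.1 hd)), if_pos (hd2.1 hd)]
        nlinarith
      · rw [max_eq_right (not_le.1 hd).le]
        refine h2.trans ?_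
        have hq' : ¬ dir (N q - q) := fun h => hd (hd2.2 h)
        simp only [h, if_neg hq', if_neg (fun h => hq' (hd1.1 h))]
        nlinarith
    have : M * ‖e (p - q)‖ ≤ M * (c * (2 * dist p q)) := by gcongr
    rw [← mul_assoc, hcM] at this
    linarith
  have hpd : (T : Set V).PairwiseDisjoint box := by
    intro p hp q hq hpq
    rw [Function.onFun, Set.disjoint_left]
    intro z hzp hzq
    rcases le_total (r p) (r q) with hr | hr
    · exact hdisj p hp q hq hpq hr z hzp hzq
    · exact hdisj q hq p hp hpq.symm hr z hzq hzp
  have hvol : ∀ x y a b : ℝ, 0 ≤ a → MeasureTheory.volume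
      (Set.Icc (x - a) (x + a) ×ˢ Set.Icc (y - b) (y + b)) = ENNReal.ofReal (4 * (a * b)) := by
    intro x y a b ha
    rw [MeasureTheory.Measure.volume_eq_prod, MeasureTheory.Measure.prod_prod, Real.volume_Icc,
      Real.volume_Icc, ← ENNReal.ofReal_mul (by linarith)]
    congr 1
    ring
  have hsub : (⋃ p ∈ T, box p) ⊆
      Set.Icc ((e o).1 - (M + 1) * D) ((e o).1 + (M + 1) * D) ×ˢ
        Set.Icc ((e o).2 - (M + 1) * D) ((e o).2 + (M + 1) * D) := by
    intro z hz
    simp only [Set.mem_iUnion] at hz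
    obtain ⟨p, hp, hz⟩ := hz
    have h1 : ‖e (p - o)‖ ≤ M * D := by
      refine (he _).trans ?_
      rw [← dist_eq_norm]
      have := hTD p hp o ho
      gcongr
    have h2 := abs_le.1 ((norm_fst_le (e (p - o))).trans h1)
    have h3 := abs_le.1 ((norm_snd_le (e (p - o))).trans h1)
    rw [map_sub, Prod.fst_sub] at h2
    rw [map_sub, Prod.snd_sub] at h3
    have := hwD p hp
    have := hhD p hp
    simp only [box, Set.mem_prod, Set.mem_Icc] at hz ⊢
    refine ⟨⟨?_, ?_⟩, ⟨?_, ?_⟩⟩ <;> linarith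
  have hmeas := MeasureTheory.measure_mono (μ := MeasureTheory.volume) hsub
  rw [MeasureTheory.measure_biUnion_finset hpd
      (fun p _ => measurableSet_Icc.prod measurableSet_Icc),
    hvol _ _ _ _ (by positivity),
    Finset.sum_congr rfl (fun p hp => (hvol _ _ _ _ (hw0 p hp)).trans (by rw [hwh p hp])),
    Finset.sum_const, nsmul_eq_mul, ← ENNReal.ofReal_natCast,
    ← ENNReal.ofReal_mul (by positivity), ENNReal.ofReal_le_ofReal_iff (by positivity)] at hmeas
  have hfin : (8 * M) ^ 2 * (T.card * (4 * (c ^ 2 * A))) ≤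
      (8 * M) ^ 2 * (4 * ((M + 1) * D * ((M + 1) * D))) := by gcongr
  have hc8 : (8 * M) ^ 2 * c ^ 2 = 1 := by
    rw [← mul_pow, mul_assoc, hcM]; norm_num
  have : (8 * M) ^ 2 * (T.card * (4 * (c ^ 2 * A))) = 4 * (T.card * A) := by
    calc _ = ((8 * M) ^ 2 * c ^ 2) * (4 * (T.card * A)) := by ring
      _ = _ := by rw [hc8, one_mul]
  rw [this] at hfin
  nlinarith

theorem card_le_of_integer_dist [StrictConvexSpace ℝ V] (hdim : Module.finrank ℝ V = 2)
    (e : V ≃L[ℝ] ℝ × ℝ) {M : ℝ} (hM : 1 ≤ M)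
    (he : ∀ v, ‖e v‖ ≤ M * ‖v‖) (he' : ∀ v, ‖v‖ ≤ M * ‖e v‖) {T : Finset V} {D : ℝ} (hD : 0 ≤ D)
    (hT : ∀ p ∈ T, ∀ q ∈ T, ∃ n : ℕ, dist p q = n) (hTD : ∀ p ∈ T, ∀ q ∈ T, dist p q ≤ D) :
    (T.card : ℝ) ≤ 128 * M * (M + 1) * (D + 1) := by
  classical
  by_cases hcol : Collinear ℝ (T : Set V)
  · have := card_le_of_collinear hT hD hTD hcol
    refine this.trans ?_
    gcongr
    nlinarith
  have hnt : (T : Set V).Nontrivial := by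
    by_contra h
    exact hcol (Set.Subsingleton.induction_on (Set.not_nontrivial_iff.1 h) (collinear_empty ℝ V)
      (collinear_singleton ℝ))
  have hnear : ∀ p ∈ T, ∃ q ∈ T, q ≠ p ∧ ∀ x ∈ T, x ≠ p → dist p q ≤ dist p x := by
    intro p hp
    obtain ⟨y, hy, hyp⟩ := hnt.exists_ne p
    obtain ⟨q, hq, hmin⟩ := (T.erase p).exists_min_image (dist p)
      ⟨y, Finset.mem_erase.2 ⟨hyp, hy⟩⟩
    rw [Finset.mem_erase] at hq
    exact ⟨q, hq.2, hq.1, fun x hx hxp => hmin x (Finset.mem_erase.2 ⟨hxp, hx⟩)⟩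
  choose! N hN hNp hmin using hnear
  have hpos : 0 < (T.card : ℝ) := by
    obtain ⟨y, hy⟩ := hnt.nonempty
    exact_mod_cast Finset.card_pos.2 ⟨y, hy⟩
  have hs0 : ∀ p ∈ T, 0 < dist p (N p) := fun p hp => dist_pos.2 (hNp p hp).symm
  let r : V → ℝ := fun p => T.card / 243 / dist p (N p)
  have hfar : ∀ p ∈ T, ∀ q ∈ T, ¬ Collinear ℝ {p, N p, q} → r p ≤ dist p q := by
    intro p hp q hq h
    have := card_le_of_not_collinear hdim hT hp (hN p hp) hq h
    simp only [r]
    rw [div_le_iff₀ (hs0 p hp)]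
    linarith
  have key := card_mul_le_of_locally_collinear e hM he he' hTD (A := T.card / 243)
    (s := fun p => dist p (N p)) (r := r) hN hNp (fun _ _ => rfl) hmin
    (fun p hp q hq h => by
      by_contra h'
      exact absurd (hfar p hp q hq h') (not_le.2 h))
    (fun p hp => by
      have := (hs0 p hp).ne'
      simp only [r]; field_simp)
    (fun p hp => by
      have := hs0 p hp
      positivity)
    (fun p hp => by
      by_contra hlt
      refine hcol ?_
      have hall : ∀ q ∈ T, Collinear ℝ {p, N p, q} := by
        intro q hq
        by_contra h
        exact hlt ((hfar p hp q hq h).trans (hTD p hp q hq))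
      refine (collinear_iff_of_mem (Finset.mem_coe.2 hp)).2 ⟨N p - p, fun q hq => ?_⟩
      obtain ⟨t, ht⟩ := (hall q hq).exists_sub_eq_smul_sub (hNp p hp)
      exact ⟨t, by rw [← ht, vadd_eq_add, sub_add_cancel]⟩)
  have h2 : (T.card : ℝ) ^ 2 ≤ (128 * M * (M + 1) * D) ^ 2 := by
    have : 0 ≤ (8 * M * (M + 1) * D) ^ 2 := by positivity
    nlinarith
  have h3 := (sq_le_sq₀ hpos.le (by positivity)).1 h2
  have h4 : 0 ≤ 128 * M * (M + 1) := by positivity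
  linarith

end IntegerDistances

/-- Diameter bound: in a 2-dimensional strictly convex normed space, there is a constant
`C > 0` such that every integer-distance set of diameter at most `D` has at most
`C * (D + 1)` points. -/
theorem erdos_anning_diameter_strictly_convex
    {V : Type*} [NormedAddCommGroup V] [NormedSpace ℝ V]
    (hdim : Module.finrank ℝ V = 2) [StrictConvexSpace ℝ V] :
    ∃ C : ℝ, 0 < C ∧
      ∀ D : ℝ, 0 ≤ D → ∀ S : Set V,
        (∀ p ∈ S, ∀ q ∈ S, ∃ n : ℕ, ‖p - q‖ = n) →
        (∀ p ∈ S, ∀ q ∈ S, ‖p - q‖ ≤ D) →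
        S.Finite ∧ (S.ncard : ℝ) ≤ C * (D + 1) := by
  have : FiniteDimensional ℝ V := Module.finite_of_finrank_eq_succ hdim
  let e : V ≃L[ℝ] ℝ × ℝ := ContinuousLinearEquiv.ofFinrankEq (by simp [hdim])
  let M : ℝ := 1 + ‖(e : V →L[ℝ] ℝ × ℝ)‖ + ‖(e.symm : ℝ × ℝ →L[ℝ] V)‖
  have h1 := norm_nonneg (e : V →L[ℝ] ℝ × ℝ)
  have h2 := norm_nonneg (e.symm : ℝ × ℝ →L[ℝ] V)
  have hM : 1 ≤ M := by simp only [M]; linarith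
  have he : ∀ v, ‖e v‖ ≤ M * ‖v‖ := fun v =>
    ((e : V →L[ℝ] ℝ × ℝ).le_opNorm v).trans (by gcongr; simp only [M]; linarith)
  have he' : ∀ v, ‖v‖ ≤ M * ‖e v‖ := fun v => by
    have := (e.symm : ℝ × ℝ →L[ℝ] V).le_opNorm (e v)
    simp only [ContinuousLinearEquiv.coe_coe, ContinuousLinearEquiv.symm_apply_apply] at this
    exact this.trans (by gcongr; simp only [M]; linarith)
  refine ⟨128 * M * (M + 1), by positivity, fun D hD S hS hSD => ?_⟩
  simp only [← dist_eq_norm] at hS hSD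
  have hcard : ∀ T : Finset V, (T : Set V) ⊆ S → (T.card : ℝ) ≤ 128 * M * (M + 1) * (D + 1) :=
    fun T hTS => card_le_of_integer_dist hdim e hM he he' hD
      (fun p hp q hq => hS p (hTS hp) q (hTS hq)) (fun p hp q hq => hSD p (hTS hp) q (hTS hq))
  have hfin : S.Finite := by
    by_contra hinf
    obtain ⟨n, hn⟩ := exists_nat_gt (128 * M * (M + 1) * (D + 1))
    obtain ⟨T, hTS, hTn⟩ := Set.Infinite.exists_subset_card_eq hinf n
    have := hcard T hTS
    rw [hTn] at this
    linarith
  refine ⟨hfin, ?_⟩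
  rw [Set.ncard_eq_toFinset_card S hfin]
  exact hcard _ (by simp)
end

section
/- Let i, j, k be three distinct indices such that the sites s i, s j, s k are not collinear (¬ Collinear ℝ {s i, s j, s k}). Then the triple intersection Vor i ∩ Vor j ∩ Vor k contains at most two points, i.e., (Vor i ∩ Vor j ∩ Vor k).ncard ≤ 2 and this set is finite. -/
/-- The additively weighted Voronoi cell of the site `s i` with weights `w`:
the set of points whose weighted distance to `s i` is at most the weighted
distance to every other site. -/
def vorCell {V : Type*} [NormedAddCommGroup V] {ι : Type*}
    (s : ι → V) (w : ι → ℝ) (i : ι) : Set V :=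
  {p : V | ∀ j, ‖p - s i‖ + w i ≤ ‖p - s j‖ + w j}

/-- A site `s i` is degenerate if it belongs to the Voronoi cell of another site. -/
def IsDegenerateSite {V : Type*} [NormedAddCommGroup V] {ι : Type*}
    (s : ι → V) (w : ι → ℝ) (i : ι) : Prop :=
  ∃ j, j ≠ i ∧ s i ∈ vorCell s w j

theorem Wbtw.wbtw_or_wbtw_of_left_ne {V : Type*} [AddCommGroup V] [Module ℝ V] {p x a b : V}
    (ha : Wbtw ℝ p x a) (hb : Wbtw ℝ p x b) (hx : x ≠ p) :
    Wbtw ℝ p a b ∨ Wbtw ℝ p b a := by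
  apply wbtw_total_of_sameRay_vsub_left
  exact ha.sameRay_vsub_left.symm.trans hb.sameRay_vsub_left
    fun h => (hx (sub_eq_zero.1 h)).elim

section Metric

variable {V : Type*} [NormedAddCommGroup V] [NormedSpace ℝ V] [StrictConvexSpace ℝ V]

/-- If `a` lies between `p` and `b`, and `q ≠ p` has the same differences of distances to
`a`, `b`, `c` as `p`, then `a`, `b`, `c` are collinear. -/
theorem collinear_of_wbtw_of_dist_add_eq {p q a b c : V} (hpq : p ≠ q) (hne : a ≠ b)
    (hab : dist p a + dist q b = dist q a + dist p b)
    (hac : dist p a + dist q c = dist q a + dist p c) (h : Wbtw ℝ p a b) :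
    Collinear ℝ {a, b, c} := by
  have hq : Wbtw ℝ q a b := by
    rw [← dist_add_dist_eq_iff] at h ⊢
    linarith
  have key : ∀ {p q : V}, p ≠ q → dist p a + dist q b = dist q a + dist p b →
      dist p a + dist q c = dist q a + dist p c → Wbtw ℝ p a b → Wbtw ℝ b p q →
      Collinear ℝ {a, b, c} := by
    intro p q hpq hab hac h hb
    have hc : Wbtw ℝ q p c := by
      rw [← dist_add_dist_eq_iff] at hb ⊢
      rw [dist_comm b p, dist_comm b q] at hb
      rw [dist_comm q p]
      linarith
    have hb' : b ∈ line[ℝ, p, q] := by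
      rw [Set.pair_comm]
      exact hb.left_mem_affineSpan_of_right_ne hpq.symm
    have hc' : c ∈ line[ℝ, p, q] := by
      rw [Set.pair_comm]
      exact hc.right_mem_affineSpan_of_left_ne hpq.symm
    have ha' : a ∈ line[ℝ, p, q] :=
      affineSpan_pair_le_of_mem_of_mem (left_mem_affineSpan_pair ℝ p q) hb' h.mem_affineSpan
    exact collinear_triple_of_mem_affineSpan_pair ha' hb' hc'
  rcases h.symm.wbtw_or_wbtw_of_left_ne hq.symm hne with h' | h'
  · exact key hpq hab hac h h'
  · exact key hpq.symm hab.symm hac.symm hq h'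

/-- If two distinct points have the same differences of distances to `a`, `b`, `c`, and the
segment from one to `a` meets the segment from the other to `b`, then `a`, `b`, `c` are
collinear. -/
theorem collinear_of_wbtw_wbtw_of_dist_add_eq {p q a b c x : V} (hpq : p ≠ q) (hne : a ≠ b)
    (hab : dist p a + dist q b = dist q a + dist p b)
    (hac : dist p a + dist q c = dist q a + dist p c)
    (hpx : Wbtw ℝ p x a) (hqx : Wbtw ℝ q x b) :
    Collinear ℝ {a, b, c} := by
  have hpa := dist_add_dist_eq_iff.2 hpx
  have hqb := dist_add_dist_eq_iff.2 hqx
  have hpb := dist_triangle p x b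
  have hqa := dist_triangle q x a
  have hpx' : Wbtw ℝ p x b := dist_add_dist_eq_iff.1 (by linarith)
  have hqx' : Wbtw ℝ q x a := dist_add_dist_eq_iff.1 (by linarith)
  have key : ∀ {p q : V}, p ≠ q → dist p a + dist q b = dist q a + dist p b →
      dist p a + dist q c = dist q a + dist p c → Wbtw ℝ p x a → Wbtw ℝ p x b → x ≠ p →
      Collinear ℝ {a, b, c} := by
    intro p q hpq hab hac ha hb hx
    rcases ha.wbtw_or_wbtw_of_left_ne hb hx with h | h
    · exact collinear_of_wbtw_of_dist_add_eq hpq hne hab hac h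
    · rw [Set.insert_comm]
      exact collinear_of_wbtw_of_dist_add_eq hpq hne.symm (by linarith) (by linarith) h
  by_cases hx : x = p
  · exact key hpq.symm hab.symm hac.symm hqx' hqx (hx ▸ hpq)
  · exact key hpq hab hac hpx hpx' hx

end Metric

section Crossing

variable {V : Type*} [AddCommGroup V] [Module ℝ V]

theorem exists_wbtw_wbtw_of_barycentric {a b c : V} {α₁ β₁ γ₁ α₂ β₂ γ₂ : ℝ}
    (h₁ : α₁ + β₁ + γ₁ = 1) (h₂ : α₂ + β₂ + γ₂ = 1) (hγ : 0 < γ₁ * γ₂)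
    (hA : 0 ≤ γ₁ * (β₁ * γ₂ - γ₁ * β₂)) (hB : 0 ≤ γ₁ * (γ₁ * α₂ - α₁ * γ₂)) :
    ∃ x, Wbtw ℝ (α₁ • a + β₁ • b + γ₁ • c) x a ∧ Wbtw ℝ (α₂ • a + β₂ • b + γ₂ • c) x b := by
  set D := γ₂ * β₁ + γ₁ * α₂ + γ₁ * γ₂ with hD
  have hα₁ : α₁ = 1 - β₁ - γ₁ := by linarith
  have hβ₂ : β₂ = 1 - α₂ - γ₂ := by linarith
  obtain ⟨hD0, ht, ht', hu, hu'⟩ :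
      D ≠ 0 ∧ 0 ≤ γ₂ / D ∧ γ₂ / D ≤ 1 ∧ 0 ≤ γ₁ / D ∧ γ₁ / D ≤ 1 := by
    rcases pos_and_pos_or_neg_and_neg_of_mul_pos hγ with ⟨g₁, g₂⟩ | ⟨g₁, g₂⟩
    · have hA' := nonneg_of_mul_nonneg_right hA g₁
      have hB' := nonneg_of_mul_nonneg_right hB g₁
      have e₁ : γ₁ ≤ D := by rw [hD]; subst hβ₂; linarith
      have e₂ : γ₂ ≤ D := by rw [hD]; subst hα₁; linarith
      have hpos : 0 < D := g₁.trans_le e₁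
      exact ⟨hpos.ne', by positivity, (div_le_one hpos).2 e₂, by positivity,
        (div_le_one hpos).2 e₁⟩
    · have hA' := nonpos_of_mul_nonneg_right hA g₁
      have hB' := nonpos_of_mul_nonneg_right hB g₁
      have e₁ : D ≤ γ₁ := by rw [hD]; subst hβ₂; linarith
      have e₂ : D ≤ γ₂ := by rw [hD]; subst hα₁; linarith
      have hneg : D < 0 := e₁.trans_lt g₁
      exact ⟨hneg.ne, div_nonneg_of_nonpos g₂.le hneg.le, (div_le_one_of_neg hneg).2 e₂,
        div_nonneg_of_nonpos g₁.le hneg.le, (div_le_one_of_neg hneg).2 e₁⟩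
  refine ⟨(γ₂ / D) • (α₁ • a + β₁ • b + γ₁ • c) + (1 - γ₂ / D) • a, ?_, ?_⟩
  · rw [← mem_segment_iff_wbtw]
    exact ⟨_, _, ht, by linarith, by ring, rfl⟩
  · rw [← mem_segment_iff_wbtw]
    refine ⟨γ₁ / D, 1 - γ₁ / D, hu, by linarith, by ring, ?_⟩
    subst hα₁ hβ₂
    match_scalars <;> field_simp <;> rw [hD] <;> ring

theorem wbtw_of_barycentric {a b : V} {α β : ℝ} (h : α + β = 1) (hβ : β ≤ 0) :
    Wbtw ℝ (α • a + β • b) a b := by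
  have hα : 0 < α := by linarith
  rw [← mem_segment_iff_wbtw]
  refine ⟨1 / α, -β / α, by positivity, div_nonneg (by linarith) hα.le, by field_simp; linarith, ?_⟩
  match_scalars <;> field_simp
  ring

end Crossing

section Signs

/-- At least two of three real numbers are positive. -/
def TwoPositive (α β γ : ℝ) : Prop :=
  0 < α ∧ 0 < β ∨ 0 < β ∧ 0 < γ ∨ 0 < γ ∧ 0 < α

variable {α₁ β₁ γ₁ α₂ β₂ γ₂ : ℝ}

theorem false_of_common_positive_pair
    (hα : 0 < α₁ * α₂ → (γ₁ * α₂ - α₁ * γ₂) * (α₁ * β₂ - β₁ * α₂) < 0)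
    (hβ : 0 < β₁ * β₂ → (α₁ * β₂ - β₁ * α₂) * (β₁ * γ₂ - γ₁ * β₂) < 0)
    (hγ : 0 < γ₁ * γ₂ → (β₁ * γ₂ - γ₁ * β₂) * (γ₁ * α₂ - α₁ * γ₂) < 0)
    (a₁ : 0 < α₁) (b₁ : 0 < β₁) (a₂ : 0 < α₂) (b₂ : 0 < β₂) : False := by
  have hBC := hα (mul_pos a₁ a₂)
  have hCA := hβ (mul_pos b₁ b₂)
  have e₁ : α₁ * (β₁ * γ₂ - γ₁ * β₂) + β₁ * (γ₁ * α₂ - α₁ * γ₂)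
    + γ₁ * (α₁ * β₂ - β₁ * α₂) = 0 := by ring
  have e₂ : α₂ * (β₁ * γ₂ - γ₁ * β₂) + β₂ * (γ₁ * α₂ - α₁ * γ₂)
    + γ₂ * (α₁ * β₂ - β₁ * α₂) = 0 := by ring
  generalize β₁ * γ₂ - γ₁ * β₂ = A at *
  generalize γ₁ * α₂ - α₁ * γ₂ = B at *
  generalize α₁ * β₂ - β₁ * α₂ = C at *
  rcases lt_trichotomy C 0 with hC | hC | hC
  · have hA : 0 < A := by nlinarith
    have hB : 0 < B := by nlinarith
    have g₁ : 0 < γ₁ := by nlinarith [mul_pos a₁ hA, mul_pos b₁ hB]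
    have g₂ : 0 < γ₂ := by nlinarith [mul_pos a₂ hA, mul_pos b₂ hB]
    nlinarith [hγ (mul_pos g₁ g₂), mul_pos hA hB]
  · simp [hC] at hBC
  · have hA : A < 0 := by nlinarith
    have hB : B < 0 := by nlinarith
    have g₁ : 0 < γ₁ := by nlinarith [mul_neg_of_pos_of_neg a₁ hA, mul_neg_of_pos_of_neg b₁ hB]
    have g₂ : 0 < γ₂ := by nlinarith [mul_neg_of_pos_of_neg a₂ hA, mul_neg_of_pos_of_neg b₂ hB]
    nlinarith [hγ (mul_pos g₁ g₂), mul_pos_of_neg_of_neg hA hB]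

theorem false_of_positive_pairs
    (hα : 0 < α₁ * α₂ → (γ₁ * α₂ - α₁ * γ₂) * (α₁ * β₂ - β₁ * α₂) < 0)
    (hβ : 0 < β₁ * β₂ → (α₁ * β₂ - β₁ * α₂) * (β₁ * γ₂ - γ₁ * β₂) < 0)
    (hγ : 0 < γ₁ * γ₂ → (β₁ * γ₂ - γ₁ * β₂) * (γ₁ * α₂ - α₁ * γ₂) < 0)
    (a₁ : 0 < α₁) (b₁ : 0 < β₁) (a₂ : 0 < α₂) (c₂ : 0 < γ₂) : False := by
  by_cases b₂ : 0 < β₂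
  · exact false_of_common_positive_pair hα hβ hγ a₁ b₁ a₂ b₂
  by_cases c₁ : 0 < γ₁
  · exact false_of_common_positive_pair hγ hα hβ c₁ a₁ c₂ a₂
  have hB : γ₁ * α₂ - α₁ * γ₂ < 0 := by nlinarith [mul_pos a₁ c₂]
  have hC : α₁ * β₂ - β₁ * α₂ < 0 := by nlinarith [mul_pos b₁ a₂]
  nlinarith [hα (mul_pos a₁ a₂), mul_pos_of_neg_of_neg hB hC]

theorem not_twoPositive_and_twoPositive
    (hα : 0 < α₁ * α₂ → (γ₁ * α₂ - α₁ * γ₂) * (α₁ * β₂ - β₁ * α₂) < 0)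
    (hβ : 0 < β₁ * β₂ → (α₁ * β₂ - β₁ * α₂) * (β₁ * γ₂ - γ₁ * β₂) < 0)
    (hγ : 0 < γ₁ * γ₂ → (β₁ * γ₂ - γ₁ * β₂) * (γ₁ * α₂ - α₁ * γ₂) < 0) :
    ¬ (TwoPositive α₁ β₁ γ₁ ∧ TwoPositive α₂ β₂ γ₂) := by
  have hα' : 0 < α₂ * α₁ → (γ₂ * α₁ - α₂ * γ₁) * (α₂ * β₁ - β₂ * α₁) < 0 :=
    fun h => by linarith [hα (by linarith)]
  have hβ' : 0 < β₂ * β₁ → (α₂ * β₁ - β₂ * α₁) * (β₂ * γ₁ - γ₂ * β₁) < 0 :=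
    fun h => by linarith [hβ (by linarith)]
  have hγ' : 0 < γ₂ * γ₁ → (β₂ * γ₁ - γ₂ * β₁) * (γ₂ * α₁ - α₂ * γ₁) < 0 :=
    fun h => by linarith [hγ (by linarith)]
  rintro ⟨⟨x₁, y₁⟩ | ⟨x₁, y₁⟩ | ⟨x₁, y₁⟩, ⟨x₂, y₂⟩ | ⟨x₂, y₂⟩ | ⟨x₂, y₂⟩⟩
  · exact false_of_common_positive_pair hα hβ hγ x₁ y₁ x₂ y₂
  · exact false_of_positive_pairs hβ' hγ' hα' x₂ y₂ y₁ x₁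
  · exact false_of_positive_pairs hα hβ hγ x₁ y₁ y₂ x₂
  · exact false_of_positive_pairs hβ hγ hα x₁ y₁ y₂ x₂
  · exact false_of_common_positive_pair hβ hγ hα x₁ y₁ x₂ y₂
  · exact false_of_positive_pairs hγ' hα' hβ' x₂ y₂ y₁ x₁
  · exact false_of_positive_pairs hα' hβ' hγ' x₂ y₂ y₁ x₁
  · exact false_of_positive_pairs hγ hα hβ x₁ y₁ y₂ x₂
  · exact false_of_common_positive_pair hγ hα hβ x₁ y₁ x₂ y₂

theorem false_of_common_positive
    (hα : 0 < α₁ * α₂ → (γ₁ * α₂ - α₁ * γ₂) * (α₁ * β₂ - β₁ * α₂) < 0)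
    (hβ : 0 < β₁ * β₂ → (α₁ * β₂ - β₁ * α₂) * (β₁ * γ₂ - γ₁ * β₂) < 0)
    (hγ : 0 < γ₁ * γ₂ → (β₁ * γ₂ - γ₁ * β₂) * (γ₁ * α₂ - α₁ * γ₂) < 0)
    (a₁ : 0 < α₁) (b₁ : β₁ < 0) (c₁ : γ₁ < 0) (a₂ : 0 < α₂) (b₂ : β₂ < 0) (c₂ : γ₂ < 0) :
    False := by
  have h₁ := hα (mul_pos a₁ a₂)
  have h₂ := hβ (mul_pos_of_neg_of_neg b₁ b₂)
  have h₃ := hγ (mul_pos_of_neg_of_neg c₁ c₂)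
  nlinarith [mul_pos (mul_pos_of_neg_of_neg h₁ h₂) (neg_pos.2 h₃),
    mul_self_nonneg ((β₁ * γ₂ - γ₁ * β₂) * (γ₁ * α₂ - α₁ * γ₂) * (α₁ * β₂ - β₁ * α₂))]

theorem false_of_distinct_positive
    (hγ : 0 < γ₁ * γ₂ → (β₁ * γ₂ - γ₁ * β₂) * (γ₁ * α₂ - α₁ * γ₂) < 0)
    (a₁ : 0 < α₁) (b₁ : β₁ < 0) (c₁ : γ₁ < 0) (a₂ : α₂ < 0) (b₂ : 0 < β₂) (c₂ : γ₂ < 0) :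
    False := by
  have hA : 0 < β₁ * γ₂ - γ₁ * β₂ := by
    linarith [mul_pos_of_neg_of_neg b₁ c₂, mul_neg_of_neg_of_pos c₁ b₂]
  have hB : 0 < γ₁ * α₂ - α₁ * γ₂ := by
    linarith [mul_pos_of_neg_of_neg c₁ a₂, mul_neg_of_pos_of_neg a₁ c₂]
  exact (mul_pos hA hB).not_gt (hγ (mul_pos_of_neg_of_neg c₁ c₂))

theorem one_positive_of_not_twoPositive {α β γ : ℝ} (h : α + β + γ = 1)
    (hα : α = 0 → 0 < β ∧ 0 < γ) (hβ : β = 0 → 0 < γ ∧ 0 < α) (hγ : γ = 0 → 0 < α ∧ 0 < β)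
    (hT : ¬ TwoPositive α β γ) :
    (0 < α ∧ β < 0 ∧ γ < 0) ∨ (α < 0 ∧ 0 < β ∧ γ < 0) ∨ (α < 0 ∧ β < 0 ∧ 0 < γ) := by
  unfold TwoPositive at hT
  rcases lt_trichotomy α 0 with a | a | a <;> rcases lt_trichotomy β 0 with b | b | b <;>
    rcases lt_trichotomy γ 0 with c | c | c <;> first | linarith | tauto

theorem twoPositive_or_twoPositive
    (h₁ : α₁ + β₁ + γ₁ = 1) (h₂ : α₂ + β₂ + γ₂ = 1)
    (hα₁ : α₁ = 0 → 0 < β₁ ∧ 0 < γ₁) (hβ₁ : β₁ = 0 → 0 < γ₁ ∧ 0 < α₁)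
    (hγ₁ : γ₁ = 0 → 0 < α₁ ∧ 0 < β₁)
    (hα₂ : α₂ = 0 → 0 < β₂ ∧ 0 < γ₂) (hβ₂ : β₂ = 0 → 0 < γ₂ ∧ 0 < α₂)
    (hγ₂ : γ₂ = 0 → 0 < α₂ ∧ 0 < β₂)
    (hα : 0 < α₁ * α₂ → (γ₁ * α₂ - α₁ * γ₂) * (α₁ * β₂ - β₁ * α₂) < 0)
    (hβ : 0 < β₁ * β₂ → (α₁ * β₂ - β₁ * α₂) * (β₁ * γ₂ - γ₁ * β₂) < 0)
    (hγ : 0 < γ₁ * γ₂ → (β₁ * γ₂ - γ₁ * β₂) * (γ₁ * α₂ - α₁ * γ₂) < 0) :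
    TwoPositive α₁ β₁ γ₁ ∨ TwoPositive α₂ β₂ γ₂ := by
  by_contra! h
  have hα' : 0 < α₂ * α₁ → (γ₂ * α₁ - α₂ * γ₁) * (α₂ * β₁ - β₂ * α₁) < 0 :=
    fun h => by linarith [hα (by linarith)]
  have hβ' : 0 < β₂ * β₁ → (α₂ * β₁ - β₂ * α₁) * (β₂ * γ₁ - γ₂ * β₁) < 0 :=
    fun h => by linarith [hβ (by linarith)]
  have hγ' : 0 < γ₂ * γ₁ → (β₂ * γ₁ - γ₂ * β₁) * (γ₂ * α₁ - α₂ * γ₁) < 0 :=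
    fun h => by linarith [hγ (by linarith)]
  rcases one_positive_of_not_twoPositive h₁ hα₁ hβ₁ hγ₁ h.1 with
    ⟨x₁, y₁, z₁⟩ | ⟨x₁, y₁, z₁⟩ | ⟨x₁, y₁, z₁⟩ <;>
  rcases one_positive_of_not_twoPositive h₂ hα₂ hβ₂ hγ₂ h.2 with
    ⟨x₂, y₂, z₂⟩ | ⟨x₂, y₂, z₂⟩ | ⟨x₂, y₂, z₂⟩
  · exact false_of_common_positive hα hβ hγ x₁ y₁ z₁ x₂ y₂ z₂
  · exact false_of_distinct_positive hγ x₁ y₁ z₁ x₂ y₂ z₂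
  · exact false_of_distinct_positive hβ' z₂ x₂ y₂ z₁ x₁ y₁
  · exact false_of_distinct_positive hγ' x₂ y₂ z₂ x₁ y₁ z₁
  · exact false_of_common_positive hβ hγ hα y₁ z₁ x₁ y₂ z₂ x₂
  · exact false_of_distinct_positive hα y₁ z₁ x₁ y₂ z₂ x₂
  · exact false_of_distinct_positive hβ z₁ x₁ y₁ z₂ x₂ y₂
  · exact false_of_distinct_positive hα' y₂ z₂ x₂ y₁ z₁ x₁
  · exact false_of_common_positive hγ hα hβ z₁ x₁ y₁ z₂ x₂ y₂

end Signs

section NonCrossing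

variable {V : Type*} [AddCommGroup V] [Module ℝ V] {a b c p q : V} {α₁ β₁ γ₁ α₂ β₂ γ₂ : ℝ}

theorem mul_neg_of_not_crossing (hp : p = α₁ • a + β₁ • b + γ₁ • c)
    (hq : q = α₂ • a + β₂ • b + γ₂ • c) (h₁ : α₁ + β₁ + γ₁ = 1) (h₂ : α₂ + β₂ + γ₂ = 1)
    (hab : ∀ x, Wbtw ℝ p x a → ¬ Wbtw ℝ q x b) (hba : ∀ x, Wbtw ℝ p x b → ¬ Wbtw ℝ q x a)
    (hγ : 0 < γ₁ * γ₂) : (β₁ * γ₂ - γ₁ * β₂) * (γ₁ * α₂ - α₁ * γ₂) < 0 := by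
  by_contra! h
  have hne : γ₁ ≠ 0 := by rintro rfl; simp at hγ
  have h' : 0 ≤ γ₁ * (β₁ * γ₂ - γ₁ * β₂) * (γ₁ * (γ₁ * α₂ - α₁ * γ₂)) := by
    nlinarith [mul_nonneg (sq_nonneg γ₁) h]
  rcases mul_nonneg_iff.1 h' with ⟨hA, hB⟩ | ⟨hA, hB⟩
  · obtain ⟨x, hx, hx'⟩ := exists_wbtw_wbtw_of_barycentric (a := a) (b := b) (c := c) h₁ h₂ hγ hA hB
    exact hab x (hp ▸ hx) (hq ▸ hx')
  · obtain ⟨x, hx, hx'⟩ := exists_wbtw_wbtw_of_barycentric (a := b) (b := a) (c := c)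
      (α₁ := β₁) (β₁ := α₁) (α₂ := β₂) (β₂ := α₂) (γ₁ := γ₁) (γ₂ := γ₂)
      (by linarith) (by linarith) hγ (by linarith) (by linarith)
    rw [add_comm (β₁ • b), ← hp] at hx
    rw [add_comm (β₂ • b), ← hq] at hx'
    exact hba x hx hx'

theorem pos_of_not_crossing (hp : p = α₁ • a + β₁ • b + γ₁ • c) (h₁ : α₁ + β₁ + γ₁ = 1)
    (hab : ∀ x, Wbtw ℝ p x a → ¬ Wbtw ℝ q x b) (hba : ∀ x, Wbtw ℝ p x b → ¬ Wbtw ℝ q x a)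
    (hγ : γ₁ = 0) : 0 < α₁ ∧ 0 < β₁ := by
  subst hγ
  simp only [zero_smul, add_zero] at hp h₁
  constructor <;> by_contra! h
  · refine hab b ?_ (wbtw_self_right ℝ q b)
    rw [hp, add_comm]
    exact wbtw_of_barycentric (by linarith) h
  · refine hba a ?_ (wbtw_self_right ℝ q a)
    rw [hp]
    exact wbtw_of_barycentric h₁ h

/-- If no segment joining `p` to one vertex of a triangle meets a segment joining `q` to
another vertex, then exactly one of `p`, `q` has two positive barycentric coordinates. -/
theorem twoPositive_iff_not_twoPositive (hp : p = α₁ • a + β₁ • b + γ₁ • c)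
    (hq : q = α₂ • a + β₂ • b + γ₂ • c) (h₁ : α₁ + β₁ + γ₁ = 1) (h₂ : α₂ + β₂ + γ₂ = 1)
    (hab : ∀ x, Wbtw ℝ p x a → ¬ Wbtw ℝ q x b) (hba : ∀ x, Wbtw ℝ p x b → ¬ Wbtw ℝ q x a)
    (hbc : ∀ x, Wbtw ℝ p x b → ¬ Wbtw ℝ q x c) (hcb : ∀ x, Wbtw ℝ p x c → ¬ Wbtw ℝ q x b)
    (hca : ∀ x, Wbtw ℝ p x c → ¬ Wbtw ℝ q x a) (hac : ∀ x, Wbtw ℝ p x a → ¬ Wbtw ℝ q x c) :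
    TwoPositive α₁ β₁ γ₁ ↔ ¬ TwoPositive α₂ β₂ γ₂ := by
  have hp' : p = β₁ • b + γ₁ • c + α₁ • a := by rw [hp]; abel
  have hq' : q = β₂ • b + γ₂ • c + α₂ • a := by rw [hq]; abel
  have hp'' : p = γ₁ • c + α₁ • a + β₁ • b := by rw [hp]; abel
  have hq'' : q = γ₂ • c + α₂ • a + β₂ • b := by rw [hq]; abel
  have h₁' : β₁ + γ₁ + α₁ = 1 := by linarith
  have h₂' : β₂ + γ₂ + α₂ = 1 := by linarith
  have h₁'' : γ₁ + α₁ + β₁ = 1 := by linarith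
  have h₂'' : γ₂ + α₂ + β₂ = 1 := by linarith
  have hα := mul_neg_of_not_crossing hp' hq' h₁' h₂' hbc hcb
  have hβ := mul_neg_of_not_crossing hp'' hq'' h₁'' h₂'' hca hac
  have hγ := mul_neg_of_not_crossing hp hq h₁ h₂ hab hba
  have flip : ∀ {u v : V}, (∀ x, Wbtw ℝ p x u → ¬ Wbtw ℝ q x v) →
      ∀ x, Wbtw ℝ q x v → ¬ Wbtw ℝ p x u := fun h x hv hu => h x hu hv
  have hor := twoPositive_or_twoPositive h₁ h₂ (pos_of_not_crossing hp' h₁' hbc hcb)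
    (pos_of_not_crossing hp'' h₁'' hca hac) (pos_of_not_crossing hp h₁ hab hba)
    (pos_of_not_crossing hq' h₂' (flip hcb) (flip hbc))
    (pos_of_not_crossing hq'' h₂'' (flip hac) (flip hca))
    (pos_of_not_crossing hq h₂ (flip hba) (flip hab)) hα hβ hγ
  exact ⟨fun h h' => not_twoPositive_and_twoPositive hα hβ hγ ⟨h, h'⟩, hor.resolve_right⟩

end NonCrossing

theorem exists_barycentric_of_not_collinear {V : Type*} [AddCommGroup V] [Module ℝ V]
    (hdim : Module.finrank ℝ V = 2) {a b c : V} (h : ¬ Collinear ℝ {a, b, c}) (p : V) :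
    ∃ α β γ : ℝ, α + β + γ = 1 ∧ p = α • a + β • b + γ • c := by
  have : FiniteDimensional ℝ V := Module.finite_of_finrank_eq_succ hdim
  have hi := affineIndependent_iff_not_collinear_set.2 h
  have ht : affineSpan ℝ (Set.range ![a, b, c]) = ⊤ := by
    rw [hi.affineSpan_eq_top_iff_card_eq_finrank_add_one, hdim]
    rfl
  let B : AffineBasis (Fin 3) ℝ V := ⟨![a, b, c], hi, ht⟩
  have h₁ := B.sum_coord_apply_eq_one p
  have h₂ := B.linear_combination_coord_eq_self p
  rw [Fin.sum_univ_three] at h₁ h₂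
  exact ⟨_, _, _, h₁, h₂.symm⟩

theorem Set.finite_and_ncard_le_two {α : Type*} {S : Set α} (C : α → Prop)
    (h : ∀ p ∈ S, ∀ q ∈ S, p ≠ q → (C p ↔ ¬ C q)) : S.Finite ∧ S.ncard ≤ 2 := by
  have key : ∀ T ⊆ S, T.Finite → T.ncard ≤ 2 := by
    intro T hT hf
    by_contra! hlt
    obtain ⟨x, y, z, hx, hy, hz, hxy, hxz, hyz⟩ := (Set.two_lt_ncard_iff hf).1 hlt
    have h₁ := h x (hT hx) y (hT hy) hxy
    have h₂ := h x (hT hx) z (hT hz) hxz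
    have h₃ := h y (hT hy) z (hT hz) hyz
    tauto
  have hf : S.Finite := by
    by_contra hinf
    obtain ⟨T, hT, hf, hcard⟩ := Set.Infinite.exists_subset_ncard_eq hinf 3
    have := key T hT hf
    omega
  exact ⟨hf, key S subset_rfl hf⟩

/-- For three distinct, non-collinear sites, the triple intersection of their
additively weighted Voronoi cells consists of at most two points. -/
theorem vorCell_triple_intersection_card_le_two
    {V : Type*} [NormedAddCommGroup V] [NormedSpace ℝ V]
    (hdim : Module.finrank ℝ V = 2) [StrictConvexSpace ℝ V]
    {ι : Type*} [Finite ι]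
    (s : ι → V) (hs : Function.Injective s) (w : ι → ℝ)
    (i j k : ι) (hij : i ≠ j) (hik : i ≠ k) (hjk : j ≠ k)
    (hcol : ¬ Collinear ℝ ({s i, s j, s k} : Set V)) :
    (vorCell s w i ∩ vorCell s w j ∩ vorCell s w k).Finite ∧
      (vorCell s w i ∩ vorCell s w j ∩ vorCell s w k).ncard ≤ 2 := by
  have hbary := exists_barycentric_of_not_collinear hdim hcol
  choose α β γ hsum hcomb using hbary
  refine Set.finite_and_ncard_le_two (fun p => TwoPositive (α p) (β p) (γ p)) ?_
  rintro p ⟨⟨hpi, hpj⟩, hpk⟩ q ⟨⟨hqi, hqj⟩, hqk⟩ hpq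
  have eq_of_mem : ∀ {u v : ι} {x : V}, x ∈ vorCell s w u → x ∈ vorCell s w v →
      dist x (s u) + w u = dist x (s v) + w v := by
    intro u v x hu hv
    rw [dist_eq_norm, dist_eq_norm]
    exact le_antisymm (hu v) (hv u)
  have e₁ := eq_of_mem hpi hpj
  have e₂ := eq_of_mem hpi hpk
  have e₃ := eq_of_mem hqi hqj
  have e₄ := eq_of_mem hqi hqk
  have not_crossing : ∀ {a b c : V}, ({a, b, c} : Set V) = {s i, s j, s k} → a ≠ b →
      dist p a + dist q b = dist q a + dist p b → dist p a + dist q c = dist q a + dist p c →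
      ∀ x, Wbtw ℝ p x a → ¬ Wbtw ℝ q x b := by
    intro a b c hset hne hab hac x ha hb
    exact hcol (hset ▸ collinear_of_wbtw_wbtw_of_dist_add_eq hpq hne hab hac ha hb)
  have nij := hs.ne hij
  have nik := hs.ne hik
  have njk := hs.ne hjk
  exact twoPositive_iff_not_twoPositive (hcomb p) (hcomb q) (hsum p) (hsum q)
    (not_crossing (c := s k) rfl nij (by linarith) (by linarith))
    (not_crossing (c := s k) (by grind) nij.symm (by linarith) (by linarith))
    (not_crossing (c := s i) (by grind) njk (by linarith) (by linarith))
    (not_crossing (c := s i) (by grind) njk.symm (by linarith) (by linarith))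
    (not_crossing (c := s j) (by grind) nik.symm (by linarith) (by linarith))
    (not_crossing (c := s j) (by grind) nik (by linarith) (by linarith))
end

section
/- Let S be a finite set of points in ℝ × ℝ such that all lines determined by pairs of distinct points of S have distinct slopes: whenever p ≠ q and r ≠ t are points of S with {p, q} ≠ {r, t}, the vectors p − q and r − t are linearly independent over ℝ. Then there exists a set K ⊆ ℝ × ℝ that is compact, convex (Convex ℝ K), centrally symmetric (K = -K), strictly convex (StrictConvex ℝ K), and has 0 in its interior, such that for all p, q ∈ S there exists n : ℕ with gauge K (p − q) = n (i.e., the convex distance function determined by K assigns an integer distance to every pair of points of S). -/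
open scoped Topology NNReal

section StrictlyConvexSeminorm

variable {E : Type*} [NormedAddCommGroup E] [NormedSpace ℝ E]

theorem Seminorm.gauge_closedBall_zero_one (N : Seminorm ℝ E) :
    gauge (N.closedBall 0 1) = N := by
  ext x
  apply le_antisymm
  · calc gauge (N.closedBall 0 1) x ≤ gauge (N.ball 0 1) x :=
        gauge_mono (N.absorbent_ball_zero one_pos) (N.ball_subset_closedBall 0 1) x
      _ = N x := by rw [N.gauge_ball]
  · refine le_csInf (Absorbent.gauge_set_nonempty (N.absorbent_closedBall_zero one_pos)) ?_
    rintro r ⟨hr, y, hy, rfl⟩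
    rw [N.mem_closedBall_zero] at hy
    have hr : 0 < r := hr
    simp only [map_smul_eq_mul, Real.norm_eq_abs, abs_of_pos hr]
    nlinarith

theorem Seminorm.neg_closedBall_zero (N : Seminorm ℝ E) (r : ℝ) :
    -N.closedBall 0 r = N.closedBall 0 r := by
  ext x
  simp [N.mem_closedBall_zero]

theorem Seminorm.continuous_of_finiteDimensional [FiniteDimensional ℝ E] (N : Seminorm ℝ E) :
    Continuous N :=
  continuousOn_univ.1 (N.convexOn.continuousOn isOpen_univ)

theorem Seminorm.isCompact_closedBall_of_le [FiniteDimensional ℝ E] (N : Seminorm ℝ E)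
    {c : ℝ} (hc : 0 < c) (hN : ∀ x, c * ‖x‖ ≤ N x) : IsCompact (N.closedBall 0 1) := by
  have : ProperSpace E := FiniteDimensional.proper ℝ E
  refine (isCompact_closedBall (0 : E) c⁻¹).of_isClosed_subset ?_ ?_
  · rw [N.closedBall_zero_eq]
    exact isClosed_le N.continuous_of_finiteDimensional continuous_const
  · intro x hx
    rw [N.mem_closedBall_zero] at hx
    rw [mem_closedBall_zero_iff, ← one_div, le_div_iff₀ hc, mul_comm]
    exact (hN x).trans hx

theorem Seminorm.ball_subset_interior_closedBall [FiniteDimensional ℝ E] (N : Seminorm ℝ E)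
    (r : ℝ) : N.ball 0 r ⊆ interior (N.closedBall 0 r) := by
  refine interior_maximal (N.ball_subset_closedBall 0 r) ?_
  rw [N.ball_zero_eq]
  exact isOpen_lt N.continuous_of_finiteDimensional continuous_const

theorem Seminorm.strictConvex_closedBall [FiniteDimensional ℝ E] (N : Seminorm ℝ E)
    (hpos : ∀ x, x ≠ 0 → 0 < N x)
    (hstrict : ∀ x y, ¬ SameRay ℝ x y → N (x + y) < N x + N y) :
    StrictConvex ℝ (N.closedBall 0 1) := by
  intro x hx y hy hxy a b ha hb hab
  rw [N.mem_closedBall_zero] at hx hy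
  apply N.ball_subset_interior_closedBall
  rw [N.mem_ball_zero]
  have hNa : N (a • x) = a * N x := by simp [map_smul_eq_mul, abs_of_pos ha]
  have hNb : N (b • y) = b * N y := by simp [map_smul_eq_mul, abs_of_pos hb]
  have hadd := map_add_le_add N (a • x) (b • y)
  by_cases h : SameRay ℝ x y
  · have hne : N x ≠ N y := by
      intro heq
      obtain ⟨u, s, t, hs, ht, -, rfl, rfl⟩ := h.exists_eq_smul
      apply hxy
      simp only [map_smul_eq_mul, Real.norm_eq_abs, abs_of_nonneg hs, abs_of_nonneg ht] at heq
      by_cases hu : u = 0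
      · simp [hu]
      · rw [mul_right_cancel₀ (hpos u hu).ne' heq]
    rcases hne.lt_or_gt with h' | h' <;> nlinarith
  · have := hstrict (a • x) (b • y) fun h' => h <| by
      simpa [smul_smul, ha.ne', hb.ne'] using
        (h'.pos_smul_left (inv_pos.2 ha)).pos_smul_right (inv_pos.2 hb)
    nlinarith

end StrictlyConvexSeminorm

section Interpolation

variable {E : Type*} [NormedAddCommGroup E] [InnerProductSpace ℝ E]

theorem exists_seminorm_eq_norm_on_and_norm_lt (T : Finset E) {v : E} (hv : v ≠ 0)
    (hT : ∀ w ∈ T, |inner ℝ v w| < ‖v‖ * ‖w‖) :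
    ∃ g : Seminorm ℝ E, (∀ w ∈ T, g w = ‖w‖) ∧ ‖v‖ < g v := by
  have hv' : 0 < ‖v‖ := norm_pos_iff.2 hv
  have hev : ∀ᶠ a in 𝓝[>] ‖v‖⁻¹, ∀ w ∈ T, a * |inner ℝ v w| < ‖w‖ := by
    rw [Finset.eventually_all]
    intro w hw
    refine nhdsWithin_le_nhds (ContinuousAt.eventually_lt (by fun_prop) (by fun_prop) ?_)
    rw [inv_mul_lt_iff₀ hv']
    exact hT w hw
  obtain ⟨a, ha, hav⟩ := (hev.and self_mem_nhdsWithin).exists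
  have hav : ‖v‖⁻¹ < a := hav
  have ha0 : 0 < a := (inv_pos.2 hv').trans hav
  have key : ∀ w, (normSeminorm ℝ E ⊔ (innerSL ℝ (a • v)).toLinearMap.toSeminorm) w
      = max ‖w‖ (a * |inner ℝ v w|) := by
    intro w
    simp [Seminorm.sup_apply, LinearMap.toSeminorm_apply, abs_of_pos ha0]
  refine ⟨normSeminorm ℝ E ⊔ (innerSL ℝ (a • v)).toLinearMap.toSeminorm, fun w hw => ?_, ?_⟩
  · rw [key, max_eq_left (ha w hw).le]
  · rw [key, lt_max_iff]
    right
    rw [real_inner_self_eq_norm_sq, abs_of_nonneg (by positivity)]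
    have := (inv_lt_iff_one_lt_mul₀ hv').1 hav
    nlinarith

theorem exists_seminorm_add_norm_eq_natCast (V : Finset E) (h0 : ∀ v ∈ V, v ≠ 0)
    (hV : ∀ v ∈ V, ∀ w ∈ V, v ≠ w → |inner ℝ v w| < ‖v‖ * ‖w‖) :
    ∃ (c : ℝ) (p : Seminorm ℝ E), 0 < c ∧ ∀ v ∈ V, ∃ n : ℕ, c * ‖v‖ + p v = n := by
  classical
  have hg : ∀ v ∈ V, ∃ g : Seminorm ℝ E, (∀ w ∈ V.erase v, g w = ‖w‖) ∧ ‖v‖ < g v :=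
    fun v hv => exists_seminorm_eq_norm_on_and_norm_lt (V.erase v) (h0 v hv) fun w hw =>
      hV v hv w (Finset.mem_of_mem_erase hw) (Finset.ne_of_mem_erase hw).symm
  choose! g hg hgv using hg
  set L : ℝ := 1 + ∑ v ∈ V, (g v v - ‖v‖)⁻¹
  have hd : ∀ v ∈ V, 0 < g v v - ‖v‖ := fun v hv => sub_pos.2 (hgv v hv)
  have hL0 : 0 ≤ L := add_nonneg zero_le_one
    (Finset.sum_nonneg fun v hv => (inv_pos.2 (hd v hv)).le)
  set k : E → ℝ := fun v => (⌈L * ‖v‖⌉₊ - L * ‖v‖) * (g v v - ‖v‖)⁻¹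
  have hk0 : ∀ v ∈ V, 0 ≤ k v := fun v hv =>
    mul_nonneg (sub_nonneg.2 (Nat.le_ceil _)) (inv_pos.2 (hd v hv)).le
  have hk1 : ∀ v ∈ V, k v ≤ (g v v - ‖v‖)⁻¹ := fun v hv =>
    mul_le_of_le_one_left (inv_pos.2 (hd v hv)).le (by
      linarith [Nat.ceil_lt_add_one (mul_nonneg hL0 (norm_nonneg v))])
  have hp : ∀ x, (∑ v ∈ V, (k v).toNNReal • g v) x = ∑ v ∈ V, k v * g v x := by
    intro x
    rw [← FunLike.coeAddMonoidHom_apply, map_sum, Finset.sum_apply]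
    refine Finset.sum_congr rfl fun v hv => ?_
    rw [FunLike.coeAddMonoidHom_apply, smul_apply, NNReal.smul_def, Real.coe_toNNReal _ (hk0 v hv), smul_eq_mul]
  refine ⟨L - ∑ v ∈ V, k v, ∑ v ∈ V, (k v).toNNReal • g v, ?_, fun w hw => ⟨⌈L * ‖w‖⌉₊, ?_⟩⟩
  · linarith [Finset.sum_le_sum hk1]
  · have hsum : ∑ v ∈ V, k v * (g v w - ‖w‖) = k w * (g w w - ‖w‖) := by
      refine Finset.sum_eq_single_of_mem w hw fun v hv hvw => ?_
      rw [hg v hv w (Finset.mem_erase.2 ⟨hvw.symm, hw⟩), sub_self, mul_zero]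
    have hkw : k w * (g w w - ‖w‖) = ⌈L * ‖w‖⌉₊ - L * ‖w‖ :=
      inv_mul_cancel_right₀ (hd w hw).ne' _
    simp only [mul_sub, Finset.sum_sub_distrib, ← Finset.sum_mul] at hsum hkw
    rw [hp]
    linarith

theorem abs_real_inner_lt_of_linearIndependent {v w : E} (h : LinearIndependent ℝ ![v, w]) :
    |inner ℝ v w| < ‖v‖ * ‖w‖ := by
  have hv : v ≠ 0 := by simpa using h.ne_zero 0
  have hw : w ≠ 0 := by simpa using h.ne_zero 1
  refine (abs_real_inner_le_norm v w).lt_of_ne fun heq => ?_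
  obtain ⟨r, -, hr⟩ := (norm_inner_eq_norm_iff (𝕜 := ℝ) hv hw).1 heq
  exact (LinearIndependent.pair_iff' hv).1 h r hr.symm

end Interpolation


/-- For any finite planar point set all of whose connecting lines have distinct
slopes, there is a compact, centrally symmetric, strictly convex body `K` with `0`
in its interior whose associated convex distance function (Minkowski gauge) assigns
an integer distance to every pair of points of the set. -/
theorem exists_strictly_convex_body_integer_distances
    (S : Set (ℝ × ℝ)) (hfin : S.Finite)
    (hslopes : ∀ p ∈ S, ∀ q ∈ S, ∀ r ∈ S, ∀ t ∈ S,
      p ≠ q → r ≠ t → ({p, q} : Set (ℝ × ℝ)) ≠ {r, t} →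
      LinearIndependent ℝ ![p - q, r - t]) :
    ∃ K : Set (ℝ × ℝ),
      IsCompact K ∧ Convex ℝ K ∧ K = -K ∧ StrictConvex ℝ K ∧
      (0 : ℝ × ℝ) ∈ interior K ∧
      ∀ p ∈ S, ∀ q ∈ S, ∃ n : ℕ, gauge K (p - q) = n := by
  classical
  let e : (ℝ × ℝ) ≃L[ℝ] ℂ := Complex.equivRealProdCLM.symm
  have he : ∀ x : ℝ × ℝ, ‖x‖ ≤ ‖e x‖ := fun x =>
    max_le (Complex.abs_re_le_norm (e x)) (Complex.abs_im_le_norm (e x))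
  let P : Finset ((ℝ × ℝ) × (ℝ × ℝ)) :=
    (hfin.toFinset ×ˢ hfin.toFinset).filter fun x => toLex x.1 < toLex x.2
  let V : Finset ℂ := P.image fun x => e (x.1 - x.2)
  have hmem : ∀ p q, (p, q) ∈ P ↔ (p ∈ S ∧ q ∈ S) ∧ toLex p < toLex q := by simp [P]
  have hne : ∀ {p q : ℝ × ℝ}, toLex p < toLex q → p ≠ q := by
    rintro p q h rfl
    exact h.false
  obtain ⟨c, s, hc, hs⟩ := exists_seminorm_add_norm_eq_natCast V
    (by
      simp only [V, Finset.forall_mem_image]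
      rintro ⟨p, q⟩ h
      have hpq := ((hmem p q).1 h).2
      simpa [sub_eq_zero] using hne hpq)
    (by
      simp only [V, Finset.forall_mem_image]
      rintro ⟨p, q⟩ h ⟨r, t⟩ h' hd
      obtain ⟨⟨hp, hq⟩, hpq⟩ := (hmem p q).1 h
      obtain ⟨⟨hr, ht⟩, hrt⟩ := (hmem r t).1 h'
      have hli := hslopes p hp q hq r hr t ht (hne hpq) (hne hrt) (by
        rw [Ne, Set.pair_eq_pair_iff]
        rintro (⟨rfl, rfl⟩ | ⟨rfl, rfl⟩)
        · exact hd rfl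
        · exact hpq.asymm hrt)
      apply abs_real_inner_lt_of_linearIndependent
      have hcomp : ![e (p - q), e (r - t)] = e.toLinearEquiv.toLinearMap ∘ ![p - q, r - t] := by
        ext i
        fin_cases i <;> rfl
      rw [hcomp]
      exact hli.map' e.toLinearEquiv.toLinearMap e.toLinearEquiv.ker)
  let N : Seminorm ℝ (ℝ × ℝ) :=
    (c.toNNReal • normSeminorm ℝ ℂ + s).comp e.toLinearEquiv.toLinearMap
  have hN : ∀ x, N x = c * ‖e x‖ + s (e x) := fun x => by
    simp [N, NNReal.smul_def, hc.le]
  have hcN : ∀ x, c * ‖x‖ ≤ N x := fun x => by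
    rw [hN]
    nlinarith [he x, apply_nonneg s (e x)]
  refine ⟨N.closedBall 0 1, N.isCompact_closedBall_of_le hc hcN, N.convex_closedBall 0 1,
    (N.neg_closedBall_zero 1).symm, N.strictConvex_closedBall ?_ ?_,
    N.ball_subset_interior_closedBall 1 (by simp [N.mem_ball_zero]), ?_⟩
  · exact fun x hx => (mul_pos hc (norm_pos_iff.2 hx)).trans_le (hcN x)
  · intro x y hxy
    have h : ‖e x + e y‖ < ‖e x‖ + ‖e y‖ := norm_add_lt_of_not_sameRay fun h =>
      hxy ((SameRay.sameRay_map_iff e.toLinearEquiv).1 h)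
    simp only [hN, map_add]
    nlinarith [map_add_le_add s (e x) (e y)]
  · intro p hp q hq
    have hlt : ∀ p ∈ S, ∀ q ∈ S, toLex p < toLex q → ∃ n : ℕ, N (p - q) = n := by
      intro p hp q hq h
      rw [hN]
      exact hs _ (Finset.mem_image.2 ⟨(p, q), (hmem p q).2 ⟨⟨hp, hq⟩, h⟩, rfl⟩)
    rw [N.gauge_closedBall_zero_one]
    rcases lt_trichotomy (toLex p) (toLex q) with h | h | h
    · exact hlt p hp q hq h
    · rw [toLex_inj.1 h]
      exact ⟨0, by simp⟩
    · rw [map_sub_rev]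
      exact hlt q hq p hp h
end

section
/- Let U be an open convex subset of the Euclidean space E = EuclideanSpace ℝ (Fin d), and let p₁, p₂, p₃ ∈ E be three points, none of which lies in U. Then there exist two distinct indices a, b ∈ {1, 2, 3} and a function γ : ℝ → E, continuous on Set.Icc 0 1, with γ 0 = p_a, γ 1 = p_b, whose image γ '' (Set.Icc 0 1) is disjoint from U, and whose total variation satisfies eVariationOn γ (Set.Icc 0 1) ≤ ENNReal.ofReal (2 · dist p_a p_b). -/
open scoped RealInnerProductSpace

/-- A point outside a nonempty open convex set is strictly separated from it by a unit vector. -/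
theorem exists_unit_inner_lt_of_notMem_open_convex {E : Type*} [NormedAddCommGroup E]
    [InnerProductSpace ℝ E] [CompleteSpace E] {U : Set E} (hne : U.Nonempty) (hUopen : IsOpen U)
    (hUconv : Convex ℝ U) {p : E} (hp : p ∉ U) :
    ∃ u : E, ‖u‖ = 1 ∧ ∀ x ∈ U, ⟪u, x⟫ < ⟪u, p⟫ := by
  obtain ⟨f, hf⟩ := geometric_hahn_banach_open_point hUconv hUopen hp
  obtain ⟨y, rfl⟩ := (InnerProductSpace.toDual ℝ E).surjective f
  simp only [InnerProductSpace.toDual_apply_apply] at hf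
  obtain ⟨x₀, hx₀⟩ := hne
  have hy : y ≠ 0 := by
    rintro rfl
    simpa using hf x₀ hx₀
  have hy' : 0 < ‖y‖ := norm_pos_iff.2 hy
  refine ⟨‖y‖⁻¹ • y, by rw [norm_smul, norm_inv, norm_norm, inv_mul_cancel₀ hy'.ne'], ?_⟩
  intro x hx
  rw [real_inner_smul_left, real_inner_smul_left]
  exact mul_lt_mul_of_pos_left (hf x hx) (inv_pos.2 hy')

/-- Among three unit vectors, two form an angle of at most `2π/3`. -/
theorem exists_ne_neg_half_le_inner {E : Type*} [NormedAddCommGroup E]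
    [InnerProductSpace ℝ E] (u : Fin 3 → E) (hu : ∀ a, ‖u a‖ = 1) :
    ∃ a b : Fin 3, a ≠ b ∧ -(1 / 2) ≤ ⟪u a, u b⟫ := by
  by_contra! h
  have h01 := h 0 1 (by decide)
  have h02 := h 0 2 (by decide)
  have h12 := h 1 2 (by decide)
  have hs : 0 ≤ ⟪u 0 + u 1 + u 2, u 0 + u 1 + u 2⟫ := real_inner_self_nonneg
  simp only [inner_add_left, inner_add_right, real_inner_self_eq_norm_sq, hu] at hs
  rw [real_inner_comm (u 0) (u 1), real_inner_comm (u 0) (u 2),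
    real_inner_comm (u 1) (u 2)] at hs
  linarith

/-- If the outer normals `u`, `w` of two half-spaces form an angle of at most `2π/3`, then a
boundary point `p` of the first and a boundary point `q` of the second can be joined through a
common point of the half-spaces with a detour of factor at most two. -/
theorem exists_mem_halfSpaces_dist_add_dist_le {E : Type*} [NormedAddCommGroup E]
    [InnerProductSpace ℝ E] {u w p q : E} (hu : ‖u‖ = 1) (hw : ‖w‖ = 1)
    (huw : -(1 / 2) ≤ ⟪u, w⟫) :
    ∃ v : E, ⟪u, p⟫ ≤ ⟪u, v⟫ ∧ ⟪w, q⟫ ≤ ⟪w, v⟫ ∧ dist p v + dist v q ≤ 2 * dist p q := by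
  rcases le_or_gt ⟪w, q⟫ ⟪w, p⟫ with hα | hα
  · exact ⟨p, le_rfl, hα, by rw [dist_self]; linarith [dist_nonneg (x := p) (y := q)]⟩
  rcases le_or_gt ⟪u, p⟫ ⟪u, q⟫ with hβ | hβ
  · exact ⟨q, hβ, le_rfl, by rw [dist_self]; linarith [dist_nonneg (x := p) (y := q)]⟩
  obtain ⟨c, hc⟩ : ∃ c, c = ⟪u, w⟫ := ⟨_, rfl⟩
  have hc1 : c < 1 := by
    refine lt_of_le_of_ne (hc ▸ by simpa [hu, hw] using real_inner_le_norm u w) fun h => ?_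
    have : u = w := (inner_eq_one_iff_of_norm_eq_one hu hw).1 (hc ▸ h)
    subst this
    linarith
  rw [← hc] at huw
  have hs : 0 < 1 - c ^ 2 := by nlinarith
  obtain ⟨s, hsdef⟩ : ∃ s, s = 1 - c ^ 2 := ⟨_, rfl⟩
  rw [← hsdef] at hs
  obtain ⟨α, hαdef⟩ : ∃ α, α = ⟪w, q⟫ - ⟪w, p⟫ := ⟨_, rfl⟩
  obtain ⟨β, hβdef⟩ : ∃ β, β = ⟪u, p⟫ - ⟪u, q⟫ := ⟨_, rfl⟩
  have hαpos : 0 < α := by linarith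
  have hβpos : 0 < β := by linarith
  have huu : ⟪u, u⟫ = 1 := by rw [real_inner_self_eq_norm_sq, hu]; norm_num
  have hww : ⟪w, w⟫ = 1 := by rw [real_inner_self_eq_norm_sq, hw]; norm_num
  have hwu : ⟪w, u⟫ = c := by rw [real_inner_comm, hc]
  obtain ⟨e, he⟩ : ∃ e, e = (α / s) • (w - c • u) := ⟨_, rfl⟩
  obtain ⟨f, hf⟩ : ∃ f, f = (β / s) • (u - c • w) := ⟨_, rfl⟩
  obtain ⟨z, hz⟩ : ∃ z, z = q - p - e + f := ⟨_, rfl⟩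
  have hue : ⟪u, e⟫ = 0 := by
    rw [he, real_inner_smul_right, inner_sub_right, real_inner_smul_right, huu, ← hc]; ring
  have hwf : ⟪w, f⟫ = 0 := by
    rw [hf, real_inner_smul_right, inner_sub_right, real_inner_smul_right, hww, hwu]; ring
  have hwe : ⟪w, e⟫ = α := by
    rw [he, real_inner_smul_right, inner_sub_right, real_inner_smul_right, hww, hwu]
    field_simp
    exact hsdef.symm
  have huf : ⟪u, f⟫ = β := by
    rw [hf, real_inner_smul_right, inner_sub_right, real_inner_smul_right, huu, ← hc]
    field_simp
    exact hsdef.symm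
  have huz : ⟪u, z⟫ = 0 := by
    rw [hz, inner_add_right, inner_sub_right, inner_sub_right, hue, huf]; linarith
  have hwz : ⟪w, z⟫ = 0 := by
    rw [hz, inner_add_right, inner_sub_right, inner_sub_right, hwe, hwf]; linarith
  have hez : ⟪e, z⟫ = 0 := by
    rw [he, real_inner_smul_left, inner_sub_left, real_inner_smul_left, huz, hwz]; ring
  have hfz : ⟪f, z⟫ = 0 := by
    rw [hf, real_inner_smul_left, inner_sub_left, real_inner_smul_left, huz, hwz]; ring
  have hee : ⟪e, e⟫ = α ^ 2 / s := by
    nth_rewrite 1 [he]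
    rw [real_inner_smul_left, inner_sub_left, real_inner_smul_left, hue, hwe]; ring
  have hff : ⟪f, f⟫ = β ^ 2 / s := by
    nth_rewrite 1 [hf]
    rw [real_inner_smul_left, inner_sub_left, real_inner_smul_left, huf, hwf]; ring
  have hef : ⟪e, f⟫ = -c * (α * β) / s := by
    rw [he, real_inner_smul_left, inner_sub_left, real_inner_smul_left, huf, hwf]; ring
  have hze := real_inner_comm e z
  have hzf := real_inner_comm f z
  have hfe := real_inner_comm e f
  have hzz : 0 ≤ ⟪z, z⟫ := real_inner_self_nonneg
  obtain ⟨l, hl⟩ : ∃ l, l = α / (α + β) := ⟨_, rfl⟩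
  have hl0 : 0 ≤ l := by rw [hl]; positivity
  have hl1 : 1 - l = β / (α + β) := by rw [hl]; field_simp; ring
  have hl1' : 0 ≤ 1 - l := by rw [hl1]; positivity
  obtain ⟨M, hM⟩ : ∃ M, M = (α + β) ^ 2 / s + ⟪z, z⟫ := ⟨_, rfl⟩
  have hM0 : 0 ≤ M := by rw [hM]; positivity
  have hpv : dist p (p + e + l • z) = l * √M := by
    rw [dist_comm, dist_eq_norm, ← sq_eq_sq₀ (norm_nonneg _) (by positivity), mul_pow,
      Real.sq_sqrt hM0, ← real_inner_self_eq_norm_sq, show p + e + l • z - p = e + l • z by abel]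
    simp only [inner_add_left, inner_add_right, real_inner_smul_left, real_inner_smul_right,
      hee, hez, hze]
    rw [hM, mul_add, hl]
    field_simp
    ring
  have hvq : dist (p + e + l • z) q = (1 - l) * √M := by
    rw [dist_eq_norm, ← sq_eq_sq₀ (norm_nonneg _) (by positivity), mul_pow,
      Real.sq_sqrt hM0, ← real_inner_self_eq_norm_sq,
      show p + e + l • z - q = f - (1 - l) • z by rw [sub_smul, one_smul, hz]; abel]
    simp only [inner_sub_left, inner_sub_right, real_inner_smul_left, real_inner_smul_right,
      hff, hfz, hzf]
    rw [hM, mul_add, hl1]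
    field_simp
    ring
  have hpq : dist p q ^ 2 = (α ^ 2 + β ^ 2 + 2 * c * (α * β)) / s + ⟪z, z⟫ := by
    rw [dist_comm, dist_eq_norm, ← real_inner_self_eq_norm_sq,
      show q - p = e - f + z by rw [hz]; abel]
    simp only [inner_add_left, inner_add_right, inner_sub_left, inner_sub_right,
      hee, hez, hze, hff, hfz, hzf, hef, hfe]
    ring
  refine ⟨p + e + l • z, ?_, ?_, ?_⟩
  · rw [inner_add_right, inner_add_right, real_inner_smul_right, hue, huz]; simp
  · rw [inner_add_right, inner_add_right, real_inner_smul_right, hwe, hwz]; linarith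
  · rw [hpv, hvq, ← add_mul, add_sub_cancel, one_mul]
    refine Real.sqrt_le_iff.2 ⟨by positivity, ?_⟩
    rw [mul_pow, hpq, hM]
    have : (α + β) ^ 2 / s ≤ 4 * ((α ^ 2 + β ^ 2 + 2 * c * (α * β)) / s) := by
      rw [← mul_div_assoc]
      gcongr
      nlinarith [sq_nonneg (α - β), mul_pos hαpos hβpos]
    linarith

/-- The broken line from `p` through `v` to `q`, parametrized by `[0, 1]`. -/
noncomputable def brokenLine {E : Type*} [NormedAddCommGroup E] [NormedSpace ℝ E]
    (p v q : E) (t : ℝ) : E :=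
  v + max (1 - 2 * t) 0 • (p - v) + max (2 * t - 1) 0 • (q - v)

section brokenLine

variable {E : Type*} [NormedAddCommGroup E] [NormedSpace ℝ E] (p v q : E)

theorem continuous_brokenLine : Continuous (brokenLine p v q) := by
  unfold brokenLine
  fun_prop

theorem brokenLine_zero : brokenLine p v q 0 = p := by simp [brokenLine]

theorem brokenLine_one : brokenLine p v q 1 = q := by norm_num [brokenLine]

theorem brokenLine_of_le_half {t : ℝ} (ht : t ≤ 1 / 2) :
    brokenLine p v q t = AffineMap.lineMap p v (2 * t) := by
  rw [brokenLine, max_eq_left (by linarith), max_eq_right (by linarith),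
    AffineMap.lineMap_apply_module]
  module

theorem brokenLine_of_half_le {t : ℝ} (ht : 1 / 2 ≤ t) :
    brokenLine p v q t = AffineMap.lineMap v q (2 * t - 1) := by
  rw [brokenLine, max_eq_right (by linarith), max_eq_left (by linarith),
    AffineMap.lineMap_apply_module]
  module

theorem brokenLine_mem_segment_union {t : ℝ} (ht : t ∈ Set.Icc (0 : ℝ) 1) :
    brokenLine p v q t ∈ segment ℝ p v ∪ segment ℝ v q := by
  rw [segment_eq_image_lineMap, segment_eq_image_lineMap]
  rcases le_total t (1 / 2) with h | h
  · exact .inl ⟨2 * t, ⟨by linarith [ht.1], by linarith⟩, (brokenLine_of_le_half p v q h).symm⟩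
  · exact .inr ⟨2 * t - 1, ⟨by linarith, by linarith [ht.2]⟩,
      (brokenLine_of_half_le p v q h).symm⟩

theorem LipschitzOnWith.eVariationOn_Icc_le {F : Type*} [PseudoEMetricSpace F] {f : ℝ → F}
    {C : NNReal} {a b : ℝ} (hf : LipschitzOnWith C f (Set.Icc a b)) (hab : a ≤ b) :
    eVariationOn f (Set.Icc a b) ≤ C * ENNReal.ofReal (b - a) := by
  have h₁ := hf.comp_eVariationOn_le (g := id) (t := Set.Icc a b) (Set.mapsTo_id _)
  have h₂ := (monotone_id.monotoneOn (Set.Icc a b)).eVariationOn_eq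
    (Set.left_mem_Icc.2 hab) (Set.right_mem_Icc.2 hab)
  rw [Set.inter_self] at h₂
  exact h₁.trans (by gcongr; exact h₂.le)

theorem eVariationOn_brokenLine_le :
    eVariationOn (brokenLine p v q) (Set.Icc 0 1) ≤ ENNReal.ofReal (dist p v + dist v q) := by
  have hlip₁ : LipschitzOnWith (2 * nndist p v) (brokenLine p v q) (Set.Icc 0 (1 / 2)) := by
    refine LipschitzOnWith.of_dist_le_mul fun x hx y hy => ?_
    rw [brokenLine_of_le_half p v q hx.2, brokenLine_of_le_half p v q hy.2,
      dist_lineMap_lineMap, Real.dist_eq, Real.dist_eq, ← mul_sub, abs_mul]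
    simp only [NNReal.coe_mul, coe_nndist, NNReal.coe_ofNat, Nat.abs_ofNat]
    exact le_of_eq (by ring)
  have hlip₂ : LipschitzOnWith (2 * nndist v q) (brokenLine p v q) (Set.Icc (1 / 2) 1) := by
    refine LipschitzOnWith.of_dist_le_mul fun x hx y hy => ?_
    rw [brokenLine_of_half_le p v q hx.1, brokenLine_of_half_le p v q hy.1,
      dist_lineMap_lineMap, Real.dist_eq, Real.dist_eq, sub_sub_sub_cancel_right, ← mul_sub,
      abs_mul]
    simp only [NNReal.coe_mul, coe_nndist, NNReal.coe_ofNat, Nat.abs_ofNat]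
    exact le_of_eq (by ring)
  have hsplit := eVariationOn.Icc_add_Icc (brokenLine p v q) (s := Set.univ)
    (show (0 : ℝ) ≤ 1 / 2 by norm_num) (show (1 / 2 : ℝ) ≤ 1 by norm_num) (Set.mem_univ _)
  simp only [Set.univ_inter] at hsplit
  have hhalf (x y : E) :
      ((2 * nndist x y : NNReal) : ENNReal) * ENNReal.ofReal (1 / 2) = ENNReal.ofReal (dist x y) := by
    rw [← ENNReal.ofReal_coe_nnreal, ← ENNReal.ofReal_mul (NNReal.coe_nonneg _)]
    congr 1
    simp only [NNReal.coe_mul, coe_nndist, NNReal.coe_ofNat]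
    ring
  rw [← hsplit, ENNReal.ofReal_add dist_nonneg dist_nonneg, ← hhalf, ← hhalf]
  refine add_le_add ?_ ?_
  · simpa only [sub_zero] using hlip₁.eVariationOn_Icc_le (by norm_num)
  · have h := hlip₂.eVariationOn_Icc_le (by norm_num)
    rwa [show (1 - 1 / 2 : ℝ) = 1 / 2 by norm_num] at h

end brokenLine

/-- A segment with both endpoints in a closed half-space stays in that half-space. -/
theorem inner_le_inner_of_mem_segment {E : Type*} [NormedAddCommGroup E]
    [InnerProductSpace ℝ E] {u x y z : E} {r : ℝ} (hx : r ≤ ⟪u, x⟫) (hy : r ≤ ⟪u, y⟫)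
    (hz : z ∈ segment ℝ x y) : r ≤ ⟪u, z⟫ :=
  (convex_halfSpace_ge (innerₛₗ ℝ u).isLinear r).segment_subset hx hy hz

/-- If three points of `d`-dimensional Euclidean space avoid an open convex set `U`,
then two of them can be joined by a curve disjoint from `U` whose length is at most
twice their Euclidean distance. -/
theorem exists_short_curve_avoiding_open_convex
    {d : ℕ} (U : Set (EuclideanSpace ℝ (Fin d)))
    (hUopen : IsOpen U) (hUconv : Convex ℝ U)
    (p : Fin 3 → EuclideanSpace ℝ (Fin d)) (hp : ∀ a, p a ∉ U) :
    ∃ a b : Fin 3, a ≠ b ∧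
      ∃ γ : ℝ → EuclideanSpace ℝ (Fin d),
        ContinuousOn γ (Set.Icc 0 1) ∧ γ 0 = p a ∧ γ 1 = p b ∧
        Disjoint (γ '' Set.Icc 0 1) U ∧
        eVariationOn γ (Set.Icc 0 1) ≤ ENNReal.ofReal (2 * dist (p a) (p b)) := by
  rcases U.eq_empty_or_nonempty with rfl | hne
  · refine ⟨0, 1, by decide, brokenLine (p 0) (p 0) (p 1),
      (continuous_brokenLine _ _ _).continuousOn, brokenLine_zero _ _ _, brokenLine_one _ _ _,
      Set.disjoint_empty _, (eVariationOn_brokenLine_le _ _ _).trans ?_⟩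
    gcongr
    rw [dist_self]
    linarith [dist_nonneg (x := p 0) (y := p 1)]
  choose u hu hsep using fun a =>
    exists_unit_inner_lt_of_notMem_open_convex hne hUopen hUconv (hp a)
  obtain ⟨a, b, hab, hang⟩ := exists_ne_neg_half_le_inner u hu
  obtain ⟨v, hav, hbv, hdist⟩ :=
    exists_mem_halfSpaces_dist_add_dist_le (p := p a) (q := p b) (hu a) (hu b) hang
  refine ⟨a, b, hab, brokenLine (p a) v (p b), (continuous_brokenLine _ _ _).continuousOn,
    brokenLine_zero _ _ _, brokenLine_one _ _ _, ?_,
    (eVariationOn_brokenLine_le _ _ _).trans (ENNReal.ofReal_le_ofReal hdist)⟩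
  rw [Set.disjoint_left]
  rintro _ ⟨t, ht, rfl⟩ hU
  rcases brokenLine_mem_segment_union (p a) v (p b) ht with h | h
  · exact (hsep a _ hU).not_ge (inner_le_inner_of_mem_segment le_rfl hav h)
  · exact (hsep b _ hU).not_ge (inner_le_inner_of_mem_segment hbv le_rfl h)
end
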